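/- arXiv:1107.2221 — 3 statements merged into one kernel-verified Lean document; each statement's English description precedes it below -/
import Mathlib

section
/- Let C be the class of unit disk graphs that contain no complete graph on t vertices as a subgraph. Then C has truly sublinear treewidth with parameter λ = 1/2. -/
open SimpleGraph Set Metric

/-- `G` has a tree decomposition of width at most `k`. -/
def SimpleGraph.TreewidthLE {V : Type} (G : SimpleGraph V) (k : ℕ) : Prop :=
  ∃ (ι : Type) (T : SimpleGraph ι) (bag : ι → Set V),
    T.IsTree ∧
    (∀ v : V, ∃ i, v ∈ bag i) ∧
    (∀ u w : V, G.Adj u w → ∃ i, u ∈ bag i ∧ w ∈ bag i) ∧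
    (∀ v : V, (T.induce {i | v ∈ bag i}).Connected) ∧
    (∀ i, (bag i).Finite ∧ (bag i).ncard ≤ k + 1)

/-- The treewidth of a graph: the least width of a tree decomposition. -/
noncomputable def SimpleGraph.treewidth {V : Type} (G : SimpleGraph V) : ℕ :=
  sInf {k | G.TreewidthLE k}

/-- The Euclidean plane. -/
abbrev Plane : Type := EuclideanSpace ℝ (Fin 2)

/-- `c` assigns to the vertices of `G` centers of closed unit disks realizing `G` as
their intersection graph: two distinct vertices are adjacent iff the corresponding unit
disks intersect, i.e. iff their centers are at distance at most `2`. -/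
def IsUnitDiskRealization {V : Type} (G : SimpleGraph V) (c : V → Plane) : Prop :=
  ∀ u v : V, G.Adj u v ↔ u ≠ v ∧ dist (c u) (c v) ≤ 2

/-- `G` is a unit disk graph. -/
def IsUnitDiskGraph {V : Type} (G : SimpleGraph V) : Prop :=
  ∃ c : V → Plane, IsUnitDiskRealization G c

/-- A class of graphs has truly sublinear treewidth with parameter `lam ∈ (0,1)` if for
every `η > 0` there exists `β > 0` such that for every graph `G` in the class and every
vertex set `X`, `tw(G ∖ X) ≤ η` implies `tw(G) ≤ η + β·|X|^lam`. -/
def HasTrulySublinearTreewidth (C : ∀ V : Type, SimpleGraph V → Prop) (lam : ℝ) : Prop :=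
  ∀ η : ℕ, 0 < η → ∃ β : ℝ, 0 < β ∧
    ∀ (V : Type) [Fintype V] (G : SimpleGraph V), C V G →
      ∀ X : Set V, (G.induce Xᶜ).treewidth ≤ η →
        (G.treewidth : ℝ) ≤ (η : ℝ) + β * (X.ncard : ℝ) ^ lam

namespace SublinearTreewidth

/-- `K` is nonempty and any two of its vertices are joined by a walk inside `K`. -/
def SetConn {V : Type} (G : SimpleGraph V) (K : Set V) : Prop :=
  K.Nonempty ∧ ∀ u ∈ K, ∀ w ∈ K, Relation.ReflTransGen (fun x y => G.Adj x y ∧ y ∈ K) u w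

section Connectivity

variable {V : Type} {G : SimpleGraph V}

theorem reflTransGen_symm {K : Set V} {u w : V} (hu : u ∈ K)
    (h : Relation.ReflTransGen (fun x y => G.Adj x y ∧ y ∈ K) u w) :
    Relation.ReflTransGen (fun x y => G.Adj x y ∧ y ∈ K) w u := by
  suffices w ∈ K ∧ Relation.ReflTransGen (fun x y => G.Adj x y ∧ y ∈ K) w u from this.2
  induction h with
  | refl => exact ⟨hu, .refl⟩
  | tail _ hbc ih => exact ⟨hbc.2, .head ⟨hbc.1.symm, ih.1⟩ ih.2⟩

theorem SetConn.of_base {K : Set V} {u : V} (hu : u ∈ K)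
    (h : ∀ w ∈ K, Relation.ReflTransGen (fun x y => G.Adj x y ∧ y ∈ K) u w) : SetConn G K :=
  ⟨⟨u, hu⟩, fun _ hv _ hw => (reflTransGen_symm hu (h _ hv)).trans (h _ hw)⟩

theorem SetConn.subset_of_closed {K Q : Set V} (hK : SetConn G K) {u : V} (hu : u ∈ K)
    (huQ : u ∈ Q) (hQ : ∀ x ∈ Q, x ∈ K → ∀ y ∈ K, G.Adj x y → y ∈ Q) : K ⊆ Q := by
  intro w hw
  suffices w ∈ K ∧ w ∈ Q from this.2
  have h := hK.2 u hu w hw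
  clear hw
  induction h with
  | refl => exact ⟨hu, huQ⟩
  | tail _ hbc ih => exact ⟨hbc.2, hQ _ ih.2 ih.1 _ hbc.2 hbc.1⟩

theorem reflTransGen_mono {K L : Set V} (hKL : K ⊆ L) {u w : V}
    (h : Relation.ReflTransGen (fun x y => G.Adj x y ∧ y ∈ K) u w) :
    Relation.ReflTransGen (fun x y => G.Adj x y ∧ y ∈ L) u w :=
  Relation.ReflTransGen.mono (fun _ _ h => ⟨h.1, hKL h.2⟩) _ _ h

theorem setConn_singleton (v : V) : SetConn G {v} :=
  .of_base (mem_singleton v) fun w hw => by rw [mem_singleton_iff.1 hw]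

theorem SetConn.union {K L : Set V} (hK : SetConn G K) (hL : SetConn G L) {x y : V}
    (hx : x ∈ K) (hy : y ∈ L) (hxy : x = y ∨ G.Adj x y) : SetConn G (K ∪ L) := by
  have hxy' : Relation.ReflTransGen (fun a b => G.Adj a b ∧ b ∈ K ∪ L) x y := by
    rcases hxy with rfl | h
    · exact .refl
    · exact .single ⟨h, Or.inr hy⟩
  refine .of_base (Or.inl hx) fun w hw => ?_
  rcases hw with hw | hw
  · exact reflTransGen_mono subset_union_left (hK.2 x hx w hw)
  · exact hxy'.trans (reflTransGen_mono subset_union_right (hL.2 y hy w hw))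

theorem SetConn.insert {K : Set V} (hK : SetConn G K) {x y : V} (hx : x ∈ K)
    (hxy : G.Adj x y) : SetConn G (insert y K) := by
  have := hK.union (setConn_singleton y) hx (mem_singleton y) (Or.inr hxy)
  rwa [union_singleton] at this

/-- The vertices that can be reached from `v` by a walk whose later vertices lie in `U`. -/
def reach (G : SimpleGraph V) (U : Set V) (v : V) : Set V :=
  {w | Relation.ReflTransGen (fun x y => G.Adj x y ∧ y ∈ U) v w}

theorem mem_reach_self (U : Set V) (v : V) : v ∈ reach G U v := Relation.ReflTransGen.refl

theorem reach_subset {U : Set V} {v : V} (hv : v ∈ U) : reach G U v ⊆ U := by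
  intro w hw
  induction (hw : Relation.ReflTransGen _ v w) with
  | refl => exact hv
  | tail _ h _ => exact h.2

theorem reach_closed {U : Set V} {v x y : V} (hx : x ∈ reach G U v) (hy : y ∈ U)
    (h : G.Adj x y) : y ∈ reach G U v :=
  Relation.ReflTransGen.tail hx ⟨h, hy⟩

theorem setConn_reach (U : Set V) (v : V) : SetConn G (reach G U v) := by
  refine .of_base (mem_reach_self U v) fun w hw => ?_
  have hw' : Relation.ReflTransGen (fun x y => G.Adj x y ∧ y ∈ U) v w := hw
  clear hw
  induction hw' with
  | refl => exact .refl
  | tail hb hbc ih => exact ih.tail ⟨hbc.1, reach_closed hb hbc.2 hbc.1⟩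

theorem SetConn.subset_reach {K U : Set V} (hK : SetConn G K) (hKU : K ⊆ U) {v : V}
    (hv : v ∈ K) : K ⊆ reach G U v :=
  fun w hw => reflTransGen_mono hKU (hK.2 v hv w hw)

theorem reach_eq_of_mem {U : Set V} {v w : V} (hv : v ∈ U) (hw : w ∈ reach G U v) :
    reach G U w = reach G U v := by
  apply Subset.antisymm
  · exact fun x hx => Relation.ReflTransGen.trans hw hx
  · exact fun x hx => Relation.ReflTransGen.trans (reflTransGen_symm hv hw) hx

theorem setConn_of_induce_connected {K : Set V} (h : (G.induce K).Connected) : SetConn G K := by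
  obtain ⟨⟨v, hv⟩⟩ := h.nonempty
  refine .of_base hv fun w hw => ?_
  obtain ⟨p⟩ := h.preconnected ⟨v, hv⟩ ⟨w, hw⟩
  suffices ∀ a b : K, (G.induce K).Walk a b →
      Relation.ReflTransGen (fun x y => G.Adj x y ∧ y ∈ K) a.1 b.1 from this _ _ p
  intro a b q
  induction q with
  | nil => exact .refl
  | @cons a c b hac _ ih => exact .head ⟨hac, c.2⟩ ih

theorem SetConn.induce_connected {K : Set V} (h : SetConn G K) : (G.induce K).Connected := by
  obtain ⟨v, hv⟩ := h.1
  rw [connected_iff_exists_forall_reachable]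
  refine ⟨⟨v, hv⟩, fun ⟨w, hw⟩ => ?_⟩
  suffices K ⊆ {x | ∃ hx : x ∈ K, (G.induce K).Reachable ⟨v, hv⟩ ⟨x, hx⟩} from (this hw).2
  refine h.subset_of_closed hv ⟨hv, .refl _⟩ ?_
  rintro x ⟨hx, hr⟩ - y hy hxy
  exact ⟨hy, hr.trans (Adj.reachable (G := G.induce K) hxy)⟩

theorem SetConn.preimage_val {S : Set V} {K : Set V} (h : SetConn G K) (hKS : K ⊆ S) :
    SetConn (G.induce S) (Subtype.val ⁻¹' K) := by
  obtain ⟨v, hv⟩ := h.1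
  refine .of_base (u := ⟨v, hKS hv⟩) hv ?_
  rintro ⟨w, hwS⟩ hw
  suffices K ⊆ {x | ∃ hx : x ∈ S, Relation.ReflTransGen
      (fun a b => (G.induce S).Adj a b ∧ b ∈ Subtype.val ⁻¹' K) ⟨v, hKS hv⟩ ⟨x, hx⟩} from
    (this hw).2
  refine h.subset_of_closed hv ⟨hKS hv, .refl⟩ ?_
  rintro x ⟨hx, hr⟩ - y hy hxy
  exact ⟨hKS hy, hr.tail ⟨hxy, hy⟩⟩

end Connectivity

/-- Rooted-forest form of tree decompositions: `par` is the parent function of a forest (roots are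
their own parents), and the nodes whose bag contains `v` are closed under taking parents up to the
node `top v`. -/
def ForestWidthLE {V : Type} (G : SimpleGraph V) (k : ℕ) : Prop :=
  ∃ (ι : Type) (par : ι → ι) (dep : ι → ℕ) (bag : ι → Set V) (top : V → ι),
    (∀ i, par i = i ∨ dep (par i) < dep i) ∧
    (∀ v, v ∈ bag (top v)) ∧
    (∀ v i, v ∈ bag i → i ≠ top v → par i ≠ i ∧ v ∈ bag (par i)) ∧
    (∀ u w, G.Adj u w → ∃ i, u ∈ bag i ∧ w ∈ bag i) ∧
    (∀ i, (bag i).Finite ∧ (bag i).ncard ≤ k + 1)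

section Forest

variable {V : Type} {G : SimpleGraph V}

theorem exists_parent_of_isTree {ι : Type} {T : SimpleGraph ι} (hT : T.IsTree) (r : ι) :
    ∃ par : ι → ι, (∀ i, par i = i ∨ T.dist r (par i) < T.dist r i) ∧
      ∀ i j, T.Adj i j → j = par i ∨ i = par j := by
  classical
  have key : ∀ i x y, T.Adj x i → T.Adj y i → T.dist r i = T.dist r x + 1 →
      T.dist r i = T.dist r y + 1 → x = y := by
    intro i x y hx hy hdx hdy
    obtain ⟨p, hp, hpl⟩ := hT.connected.exists_path_of_dist r x
    obtain ⟨q, hq, hql⟩ := hT.connected.exists_path_of_dist r y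
    have h1 : (p.concat hx).IsPath := by
      apply Walk.isPath_of_length_eq_dist; simp [hpl, hdx]
    have h2 : (q.concat hy).IsPath := by
      apply Walk.isPath_of_length_eq_dist; simp [hql, hdy]
    have h3 := (hT.isAcyclic.subsingleton_path _ _).elim ⟨_, h1⟩ ⟨_, h2⟩
    have h4 : p.concat hx = q.concat hy := congrArg Subtype.val h3
    have h5 := congrArg Walk.penultimate h4
    simpa using h5
  let par : ι → ι := fun i =>
    if h : ∃ x, T.Adj x i ∧ T.dist r i = T.dist r x + 1 then h.choose else i
  have hpar : ∀ i x, T.Adj x i → T.dist r i = T.dist r x + 1 → par i = x := by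
    intro i x hx hdx
    have h : ∃ x, T.Adj x i ∧ T.dist r i = T.dist r x + 1 := ⟨x, hx, hdx⟩
    have : par i = h.choose := dif_pos h
    rw [this]
    exact key i _ _ h.choose_spec.1 hx h.choose_spec.2 hdx
  refine ⟨par, fun i => ?_, fun i j hij => ?_⟩
  · by_cases h : ∃ x, T.Adj x i ∧ T.dist r i = T.dist r x + 1
    · obtain ⟨x, hx, hdx⟩ := h
      rw [hpar i x hx hdx]; right; omega
    · left; exact dif_neg h
  · rcases hT.dist_eq_dist_add_one_of_adj r hij with h | h
    · left; exact (hpar i j hij.symm h).symm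
    · right; exact (hpar j i hij h).symm

theorem forestWidthLE_of_treewidthLE {k : ℕ} (h : G.TreewidthLE k) : ForestWidthLE G k := by
  obtain ⟨ι, T, bag, hT, -, hedge, hconn, hsize⟩ := h
  obtain ⟨r⟩ := hT.connected.nonempty
  obtain ⟨par, hpar, hadj⟩ := exists_parent_of_isTree hT r
  have hc : ∀ v, SetConn T {i | v ∈ bag i} := fun v => setConn_of_induce_connected (hconn v)
  have hmin : ∀ v, ∃ i, v ∈ bag i ∧ ∀ j, v ∈ bag j → T.dist r i ≤ T.dist r j := by
    intro v
    obtain ⟨i, hi, hi'⟩ := (InvImage.wf (T.dist r) wellFounded_lt).has_min _ (hc v).1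
    exact ⟨i, hi, fun j hj => not_lt.1 (hi' j hj)⟩
  choose top htop htopmin using hmin
  refine ⟨ι, par, T.dist r, bag, top, hpar, htop, ?_, hedge, hsize⟩
  intro v i hvi hne
  by_contra hcon
  have hmono : ∀ n j, T.dist r (par^[n] j) ≤ T.dist r j := by
    intro n
    induction n with
    | zero => intro j; exact le_rfl
    | succ n ih =>
      intro j
      rw [Function.iterate_succ_apply]
      refine (ih _).trans ?_
      rcases hpar j with h | h
      · rw [h]
      · exact h.le
  have hsub : {j | v ∈ bag j} ⊆ {j | ∃ n, par^[n] j = i} := by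
    refine (hc v).subset_of_closed (u := i) hvi ⟨0, rfl⟩ ?_
    rintro x ⟨n, hn⟩ hx y hy hxy
    rcases hadj x y hxy with h | h
    · cases n with
      | zero =>
        have hxi : x = i := hn
        subst hxi
        exact absurd ⟨fun h' => hxy.ne (by rw [h, h']), h ▸ hy⟩ hcon
      | succ n => exact ⟨n, by rw [h]; exact hn⟩
    · exact ⟨n + 1, by rw [Function.iterate_succ_apply, ← h]; exact hn⟩
  obtain ⟨n, hn⟩ := hsub (htop v)
  have hle := htopmin v i hvi
  cases n with
  | zero => exact hne hn.symm
  | succ n =>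
    rw [Function.iterate_succ_apply] at hn
    rcases hpar (top v) with h | h
    · rw [h] at hn
      have : ∀ m, par^[m] (top v) = top v := fun m => Function.iterate_fixed h m
      exact hne (by rw [← hn, this])
    · have := hmono n (par (top v))
      rw [hn] at this
      omega

/-- The graph on `ι` whose edges join each non-root node to its parent, together with a new
vertex `none` joined to all the roots. -/
def parentGraph {ι : Type} (par : ι → ι) : SimpleGraph (Option ι) :=
  SimpleGraph.fromRel fun a b =>
    ∃ i, a = some i ∧ ((par i = i ∧ b = none) ∨ (par i ≠ i ∧ b = some (par i)))

theorem parentGraph_isTree {ι : Type} {par : ι → ι} {dep : ι → ℕ}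
    (hpar : ∀ i, par i = i ∨ dep (par i) < dep i) : (parentGraph par).IsTree := by
  classical
  let up : Option ι → Option ι := fun a => a.bind fun i => if par i = i then none else some (par i)
  let d : Option ι → ℕ := fun a => a.elim 0 fun i => dep i + 1
  have hup : ∀ i, d (up (some i)) < d (some i) := by
    intro i
    by_cases h : par i = i
    · simp [up, d, h]
    · have := (hpar i).resolve_left h
      simp [up, d, h, this]
  have hadj : ∀ a b, (parentGraph par).Adj a b →
      (d b < d a ∧ b = up a) ∨ (d a < d b ∧ a = up b) := by
    have aux : ∀ a b, (∃ i, a = some i ∧ ((par i = i ∧ b = none) ∨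
        (par i ≠ i ∧ b = some (par i)))) → (d b < d a ∧ b = up a) := by
      rintro a b ⟨i, rfl, h⟩
      have hb : b = up (some i) := by
        rcases h with ⟨h, rfl⟩ | ⟨h, rfl⟩ <;> simp [up, h]
      exact ⟨hb ▸ hup i, hb⟩
    rintro a b ⟨-, h | h⟩
    · exact Or.inl (aux a b h)
    · exact Or.inr (aux b a h)
  have hadj' : ∀ i, (parentGraph par).Adj (some i) (up (some i)) := by
    intro i
    refine ⟨fun h => ?_, Or.inl ⟨i, rfl, ?_⟩⟩
    · have := hup i; rw [← h] at this; omega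
    · by_cases h : par i = i <;> simp [up, h]
  refine ⟨?_, ?_⟩
  · rw [connected_iff_exists_forall_reachable]
    refine ⟨none, ?_⟩
    suffices ∀ n a, d a = n → (parentGraph par).Reachable none a from fun a => this _ a rfl
    intro n
    induction n using Nat.strong_induction_on with
    | _ n ih =>
      intro a ha
      cases a with
      | none => exact .refl _
      | some i => exact (ih _ (ha ▸ hup i) _ rfl).trans (hadj' i).symm.reachable
  · intro v c hc
    obtain ⟨m, hm, hmax⟩ := c.support.toFinset.exists_max_image d ⟨v, by simp⟩
    have hm' : m ∈ c.support := by simpa using hm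
    have hc' := hc.rotate hm'
    have hmax' : ∀ x ∈ (c.rotate m hm').support, d x ≤ d m := by
      intro x hx
      apply hmax
      simpa using hx
    have h1 := hadj _ _ ((c.rotate m hm').adj_snd hc'.not_nil)
    have h2 := hadj _ _ ((c.rotate m hm').adj_penultimate hc'.not_nil)
    have h3 := hmax' _ ((c.rotate m hm').getVert_mem_support 1)
    have h4 : d (c.rotate m hm').penultimate ≤ d m :=
      hmax' _ ((c.rotate m hm').getVert_mem_support _)
    have h3' : d (c.rotate m hm').snd ≤ d m := h3
    apply hc'.snd_ne_penultimate
    rcases h1 with h1 | h1 <;> rcases h2 with h2 | h2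
    · omega
    · rw [h1.2, h2.2]
    · omega
    · omega

theorem treewidthLE_of_forestWidthLE {k : ℕ} (h : ForestWidthLE G k) : G.TreewidthLE k := by
  obtain ⟨ι, par, dep, bag, top, hpar, htop, hpars, hedge, hsize⟩ := h
  refine ⟨Option ι, parentGraph par, fun a => a.elim ∅ bag, parentGraph_isTree hpar,
    fun v => ⟨some (top v), htop v⟩, ?_, ?_, ?_⟩
  · intro u w huw
    obtain ⟨i, hi⟩ := hedge u w huw
    exact ⟨some i, hi⟩
  · intro v
    apply SetConn.induce_connected
    refine .of_base (u := some (top v)) (htop v) ?_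
    suffices ∀ n i, dep i = n → v ∈ bag i → Relation.ReflTransGen
        (fun x y => (parentGraph par).Adj x y ∧ y ∈ {a : Option ι | v ∈ a.elim ∅ bag})
        (some (top v)) (some i) by
      intro a ha
      cases a with
      | none => exact absurd ha (notMem_empty v)
      | some i => exact this _ i rfl ha
    intro n
    induction n using Nat.strong_induction_on with
    | _ n ih =>
      intro i hi hvi
      by_cases hne : i = top v
      · rw [hne]
      · obtain ⟨h1, h2⟩ := hpars v i hvi hne
        have hlt := (hpar i).resolve_left h1
        refine (ih _ (hi ▸ hlt) _ rfl h2).tail ⟨⟨?_, Or.inr ⟨i, rfl, Or.inr ⟨h1, rfl⟩⟩⟩, hvi⟩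
        intro h
        exact h1 (Option.some.inj h)
  · intro a
    cases a with
    | none => simp
    | some i => exact hsize i

theorem ForestWidthLE.mono {k l : ℕ} (h : ForestWidthLE G k) (hkl : k ≤ l) :
    ForestWidthLE G l := by
  obtain ⟨ι, par, dep, bag, top, h1, h2, h3, h4, h5⟩ := h
  exact ⟨ι, par, dep, bag, top, h1, h2, h3, h4, fun i => ⟨(h5 i).1, (h5 i).2.trans (by omega)⟩⟩

theorem treewidth_le_iff [Finite V] {k : ℕ} : G.treewidth ≤ k ↔ ForestWidthLE G k := by
  constructor
  · intro h
    have hne : {k | G.TreewidthLE k}.Nonempty := by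
      refine ⟨Nat.card V, treewidthLE_of_forestWidthLE
        ⟨Unit, id, fun _ => 0, fun _ => univ, fun _ => (), fun _ => Or.inl rfl, by simp, by simp,
          by simp, fun _ => ⟨finite_univ, by simp [ncard_univ]⟩⟩⟩
    exact (forestWidthLE_of_treewidthLE (Nat.sInf_mem hne)).mono h
  · exact fun h => Nat.sInf_le (treewidthLE_of_forestWidthLE h)

end Forest

theorem ncard_biUnion_le_mul {α β : Type} {s : Set α} (hs : s.Finite) {f : α → Set β} {c : ℕ}
    (hf : ∀ a ∈ s, (f a).Finite ∧ (f a).ncard ≤ c) :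
    (⋃ a ∈ s, f a).Finite ∧ (⋃ a ∈ s, f a).ncard ≤ s.ncard * c := by
  classical
  induction s, hs using Set.Finite.induction_on with
  | empty => simp
  | @insert a s ha hs ih =>
    obtain ⟨h1, h2⟩ := ih fun b hb => hf b (mem_insert_of_mem _ hb)
    obtain ⟨h3, h4⟩ := hf a (mem_insert _ _)
    rw [biUnion_insert, ncard_insert_of_notMem ha hs]
    refine ⟨h3.union h1, (ncard_union_le _ _).trans ?_⟩
    rw [add_mul, one_mul]
    omega

section Below

variable {V : Type} {G : SimpleGraph V} {ι : Type} {par : ι → ι} {dep : ι → ℕ}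
  {bag : ι → Set V} {top : V → ι}

/-- The vertices whose top node is a descendant of `t`. -/
def below (par : ι → ι) (top : V → ι) (t : ι) : Set V := {v | ∃ n, par^[n] (top v) = t}

theorem mem_below_top (v : V) : v ∈ below par top (top v) := ⟨0, rfl⟩

theorem dep_iterate_le (hpar : ∀ i, par i = i ∨ dep (par i) < dep i) (n : ℕ) (i : ι) :
    par^[n] i = i ∨ dep (par^[n] i) < dep i := by
  induction n generalizing i with
  | zero => exact Or.inl rfl
  | succ n ih =>
    rw [Function.iterate_succ_apply]
    rcases hpar i with h | h
    · rw [h]; exact ih i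
    · rcases ih (par i) with h' | h'
      · rw [h']; exact Or.inr h
      · exact Or.inr (h'.trans h)

theorem below_subset_of_iterate {n : ℕ} {i t : ι} (h : par^[n] i = t) :
    below par top i ⊆ below par top t := by
  rintro v ⟨m, rfl⟩
  exact ⟨n + m, by rw [Function.iterate_add_apply, h]⟩

theorem exists_iterate_eq_top (hpar : ∀ i, par i = i ∨ dep (par i) < dep i)
    (hbag : ∀ v i, v ∈ bag i → i ≠ top v → par i ≠ i ∧ v ∈ bag (par i)) {v : V} {i : ι}
    (hv : v ∈ bag i) : ∃ n, par^[n] i = top v := by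
  suffices ∀ d i, dep i = d → v ∈ bag i → ∃ n, par^[n] i = top v from this _ i rfl hv
  intro d
  induction d using Nat.strong_induction_on with
  | _ d ih =>
    intro i hi hv
    by_cases h : i = top v
    · exact ⟨0, h⟩
    · obtain ⟨h1, h2⟩ := hbag v i hv h
      obtain ⟨n, hn⟩ := ih _ (hi ▸ (hpar i).resolve_left h1) _ rfl h2
      exact ⟨n + 1, hn⟩

theorem mem_bag_or_mem_below
    (hbag : ∀ v i, v ∈ bag i → i ≠ top v → par i ≠ i ∧ v ∈ bag (par i)) {v : V} {n : ℕ} {i t : ι}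
    (hv : v ∈ bag i) (hn : par^[n] i = t) : v ∈ bag t ∨ v ∈ below par top t := by
  induction n generalizing i with
  | zero => exact Or.inl (hn ▸ hv)
  | succ n ih =>
    by_cases h : i = top v
    · exact Or.inr ⟨n + 1, h ▸ hn⟩
    · exact ih (hbag v i hv h).2 hn

theorem mem_bag_of_adj_below (hpar : ∀ i, par i = i ∨ dep (par i) < dep i)
    (hbag : ∀ v i, v ∈ bag i → i ≠ top v → par i ≠ i ∧ v ∈ bag (par i))
    (hedge : ∀ u w, G.Adj u w → ∃ i, u ∈ bag i ∧ w ∈ bag i) {u w : V} {t : ι}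
    (hu : u ∈ below par top t) (huw : G.Adj u w) : w ∈ bag t ∨ w ∈ below par top t := by
  obtain ⟨i, hui, hwi⟩ := hedge u w huw
  obtain ⟨n, hn⟩ := exists_iterate_eq_top hpar hbag hui
  obtain ⟨m, hm⟩ := hu
  exact mem_bag_or_mem_below hbag (n := m + n) hwi (by rw [Function.iterate_add_apply, hn, hm])

end Below

/-- Transfer of decompositions along a relation `R` with connected, pairwise touching fibres. -/
theorem ForestWidthLE.transfer {α β : Type} {A : SimpleGraph α} {B : SimpleGraph β} {k l c : ℕ}
    (h : ForestWidthLE A k) (R : α → β → Prop)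
    (hconn : ∀ b, SetConn A {a | R a b})
    (hadj : ∀ b b', B.Adj b b' → ∃ a a', R a b ∧ R a' b' ∧ (a = a' ∨ A.Adj a a'))
    (hcard : ∀ a, {b | R a b}.Finite ∧ {b | R a b}.ncard ≤ c) (hl : (k + 1) * c ≤ l + 1) :
    ForestWidthLE B l := by
  obtain ⟨ι, par, dep, bag, top, hpar, htop, hbag, hedge, hsize⟩ := h
  have hmin : ∀ b, ∃ a, R a b ∧ ∀ a', R a' b → dep (top a) ≤ dep (top a') := by
    intro b
    obtain ⟨a, ha, ha'⟩ :=
      (InvImage.wf (fun a => dep (top a)) wellFounded_lt).has_min {a | R a b} (hconn b).1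
    exact ⟨a, ha, fun a' h => not_lt.1 (ha' a' h)⟩
  choose f hf hfmin using hmin
  refine ⟨ι, par, dep, fun i => ⋃ a ∈ bag i, {b | R a b}, fun b => top (f b), hpar, ?_, ?_, ?_, ?_⟩
  · intro b
    exact mem_biUnion (htop (f b)) (hf b)
  · intro b i hb hne
    simp only [mem_iUnion, exists_prop, mem_ofPred_eq] at hb ⊢
    obtain ⟨a, ha, hab⟩ := hb
    by_cases hia : i = top a
    · by_contra hcon
      have hsub : {a | R a b} ⊆ below par top i := by
        refine (hconn b).subset_of_closed (u := a) hab (hia ▸ mem_below_top a) ?_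
        intro x hx hxb y hyb hxy
        rcases mem_bag_of_adj_below hpar hbag hedge hx hxy with h | h
        · by_cases hiy : i = top y
          · exact hiy ▸ mem_below_top y
          · exact absurd ⟨(hbag y i h hiy).1, y, (hbag y i h hiy).2, hyb⟩ hcon
        · exact h
      obtain ⟨n, hn⟩ := hsub (hf b)
      rcases dep_iterate_le hpar n (top (f b)) with h | h
      · exact hne (hn.symm.trans h)
      · rw [hn, hia] at h
        exact absurd (hfmin b a hab) (not_le.2 h)
    · exact ⟨(hbag a i ha hia).1, a, (hbag a i ha hia).2, hab⟩
  · intro b b' hbb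
    obtain ⟨a, a', ha, ha', h⟩ := hadj b b' hbb
    rcases h with rfl | h
    · exact ⟨top a, mem_biUnion (htop a) ha, mem_biUnion (htop a) ha'⟩
    · obtain ⟨i, hi, hi'⟩ := hedge a a' h
      exact ⟨i, mem_biUnion hi ha, mem_biUnion hi' ha'⟩
  · intro i
    obtain ⟨h1, h2⟩ := ncard_biUnion_le_mul (hsize i).1 (f := fun a => {b | R a b})
      fun a _ => hcard a
    exact ⟨h1, h2.trans ((Nat.mul_le_mul_right _ (hsize i).2).trans hl)⟩

theorem ForestWidthLE.comap {α β : Type} {A : SimpleGraph α} {B : SimpleGraph β} {k : ℕ}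
    (h : ForestWidthLE A k) (f : β → α) (hf : Function.Injective f)
    (hadj : ∀ b b', B.Adj b b' → A.Adj (f b) (f b')) : ForestWidthLE B k := by
  refine h.transfer (c := 1) (fun a b => f b = a) ?_ ?_ ?_ (by simp)
  · intro b
    have : {a | f b = a} = {f b} := by ext; simp [eq_comm]
    rw [this]; exact setConn_singleton _
  · exact fun b b' hb => ⟨f b, f b', rfl, rfl, Or.inr (hadj _ _ hb)⟩
  · intro a
    have : {b | f b = a}.Subsingleton := fun x hx y hy => hf (hx.trans hy.symm)
    have hfin := this.finite
    have := hfin.to_subtype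
    exact ⟨hfin, ncard_le_one_iff_subsingleton.2 ‹_›⟩

theorem ForestWidthLE.induce {α : Type} {A : SimpleGraph α} {k : ℕ}
    (h : ForestWidthLE A k) (S : Set α) : ForestWidthLE (A.induce S) k :=
  h.comap Subtype.val Subtype.val_injective fun _ _ => id

/-- Decompositions of the components of `G ∖ S` combine to one of `G`. -/
theorem forestWidthLE_of_components {V : Type} {G : SimpleGraph V} {S : Set V} (hS : S.Finite)
    {k l : ℕ} (hl : k + S.ncard ≤ l)
    (h : ∀ v ∉ S, ForestWidthLE (G.induce (reach G Sᶜ v)) k) : ForestWidthLE G l := by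
  classical
  have h' : ∀ K : {K : Set V // ∃ v, v ∉ S ∧ reach G Sᶜ v = K}, ForestWidthLE (G.induce K.1) k := by
    rintro ⟨K, v, hv, rfl⟩
    exact h v hv
  choose ι par dep bag top hpar htop hbag hedge hsize using h'
  have hmem : ∀ (v : V) (hv : v ∉ S) (K : {K : Set V // ∃ v, v ∉ S ∧ reach G Sᶜ v = K}),
      v ∈ K.1 → K = ⟨reach G Sᶜ v, v, hv, rfl⟩ := by
    rintro v hv ⟨K, w, hw, rfl⟩ hvK
    exact Subtype.ext (reach_eq_of_mem hw hvK).symm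
  refine ⟨Option (Σ K, ι K), fun a => a.elim none fun p =>
    if par p.1 p.2 = p.2 then none else some ⟨p.1, par p.1 p.2⟩,
    fun a => a.elim 0 fun p => dep p.1 p.2 + 1,
    fun a => a.elim S fun p => Subtype.val '' (bag p.1 p.2) ∪ S,
    fun v => if hv : v ∈ S then none else
      some ⟨⟨reach G Sᶜ v, v, hv, rfl⟩, top _ ⟨v, mem_reach_self _ _⟩⟩, ?_, ?_, ?_, ?_, ?_⟩
  · rintro (_ | ⟨K, i⟩)
    · exact Or.inl rfl
    · right
      by_cases hi : par K i = i
      · simp [hi]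
      · have := (hpar K i).resolve_left hi
        simp [hi, this]
  · intro v
    by_cases hv : v ∈ S
    · simp [hv]
    · simp only [hv, dite_false, Option.elim]
      exact Or.inl ⟨_, htop _ _, rfl⟩
  · intro v a hva hne
    by_cases hv : v ∈ S
    · rcases a with _ | ⟨K, i⟩
      · simp [hv] at hne
      · by_cases hi : par K i = i
        · simp [hi, hv]
        · simp [hi, hv]
    · rcases a with _ | ⟨K, i⟩
      · exact absurd hva hv
      · have hva' : v ∈ Subtype.val '' bag K i := by
          simpa [hv] using hva
        obtain ⟨x, hxi, hxv⟩ := hva'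
        have hvK : v ∈ K.1 := hxv ▸ x.2
        obtain rfl : x = ⟨v, hvK⟩ := Subtype.ext hxv
        obtain rfl := hmem v hv K hvK
        have hne' : i ≠ top _ ⟨v, hvK⟩ := by
          rintro rfl
          simp [hv] at hne
        obtain ⟨h1, h2⟩ := hbag _ _ i hxi hne'
        simp only [Option.elim, h1, if_false]
        refine ⟨?_, Or.inl ⟨_, h2, rfl⟩⟩
        intro h
        simp at h
        exact h1 h
  · intro u w huw
    by_cases hu : u ∈ S
    · by_cases hw : w ∈ S
      · exact ⟨none, hu, hw⟩
      · exact ⟨some ⟨⟨reach G Sᶜ w, w, hw, rfl⟩, top _ ⟨w, mem_reach_self _ _⟩⟩, Or.inr hu,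
          Or.inl ⟨_, htop _ _, rfl⟩⟩
    · by_cases hw : w ∈ S
      · exact ⟨some ⟨⟨reach G Sᶜ u, u, hu, rfl⟩, top _ ⟨u, mem_reach_self _ _⟩⟩,
          Or.inl ⟨_, htop _ _, rfl⟩, Or.inr hw⟩
      · obtain ⟨i, h1, h2⟩ := hedge ⟨reach G Sᶜ u, u, hu, rfl⟩ ⟨u, mem_reach_self _ _⟩
          ⟨w, reach_closed (mem_reach_self _ _) hw huw⟩ huw
        exact ⟨some ⟨⟨reach G Sᶜ u, u, hu, rfl⟩, i⟩, Or.inl ⟨_, h1, rfl⟩, Or.inl ⟨_, h2, rfl⟩⟩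
  · rintro (_ | ⟨K, i⟩)
    · exact ⟨hS, show S.ncard ≤ l + 1 by omega⟩
    · obtain ⟨h1, h2⟩ := hsize K i
      refine ⟨(h1.image _).union hS,
        (ncard_union_le (Subtype.val '' bag K i) S).trans ?_⟩
      have := ncard_image_le (f := Subtype.val) h1
      omega

section Marking

variable {V : Type} {G : SimpleGraph V} {ι : Type} {par : ι → ι} {dep : ι → ℕ}
  {bag : ι → Set V} {top : V → ι}

theorem mem_below_or_mem_bag_par (hpar : ∀ i, par i = i ∨ dep (par i) < dep i)
    (hbag : ∀ v i, v ∈ bag i → i ≠ top v → par i ≠ i ∧ v ∈ bag (par i))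
    (hedge : ∀ u w, G.Adj u w → ∃ i, u ∈ bag i ∧ w ∈ bag i) {u w : V} {t : ι}
    (hu : u ∈ below par top t) (huw : G.Adj u w) :
    w ∈ below par top t ∨ par t ≠ t ∧ w ∈ bag (par t) := by
  rcases mem_bag_of_adj_below hpar hbag hedge hu huw with h | h
  · by_cases ht : t = top w
    · exact Or.inl (ht ▸ mem_below_top w)
    · exact Or.inr (hbag w t h ht)
  · exact Or.inl h

theorem exists_root (hpar : ∀ i, par i = i ∨ dep (par i) < dep i) (i : ι) :
    ∃ n, par (par^[n] i) = par^[n] i := by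
  suffices ∀ d i, dep i = d → ∃ n, par (par^[n] i) = par^[n] i from this _ i rfl
  intro d
  induction d using Nat.strong_induction_on with
  | _ d ih =>
    intro i hi
    rcases hpar i with h | h
    · exact ⟨0, h⟩
    · obtain ⟨n, hn⟩ := ih _ (hi ▸ h) _ rfl
      exact ⟨n + 1, hn⟩

theorem exists_child {v : V} {t : ι} (hv : v ∈ below par top t) (ht : top v ≠ t) :
    ∃ s, par s = t ∧ s ≠ t ∧ v ∈ below par top s := by
  obtain ⟨n, hn⟩ := hv
  induction n generalizing t with
  | zero => exact absurd hn ht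
  | succ n ih =>
    by_cases h : par^[n] (top v) = t
    · exact ih ht h
    · exact ⟨_, (Function.iterate_succ_apply' par n (top v)).symm.trans hn, h, n, rfl⟩

theorem exists_marking_aux [Finite V] {η : ℕ} (hpar : ∀ i, par i = i ∨ dep (par i) < dep i)
    (hbag : ∀ v i, v ∈ bag i → i ≠ top v → par i ≠ i ∧ v ∈ bag (par i))
    (htop : ∀ v, v ∈ bag (top v))
    (hedge : ∀ u w, G.Adj u w → ∃ i, u ∈ bag i ∧ w ∈ bag i)
    (hsize : ∀ i, (bag i).ncard ≤ η + 1) (n : ℕ) : ∀ U Y : Set V, Y ⊆ U → Y.ncard = n →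
    ∃ M, Y ⊆ M ∧ M ⊆ U ∧ M.ncard ≤ (η + 2) * n ∧ ∀ D, SetConn G D → D ⊆ U → Disjoint D M →
      {m | m ∈ M ∧ ∃ v ∈ D, G.Adj v m}.ncard ≤ 2 * η + 2 := by
  induction n using Nat.strong_induction_on with
  | _ n ih =>
    intro U Y hYU hYn
    by_cases hex : ∃ t, η + 2 ≤ (Y ∩ below par top t).ncard
    · have hbdd : BddAbove (dep '' {t | η + 2 ≤ (Y ∩ below par top t).ncard}) := by
        obtain ⟨b, hb⟩ := (finite_range fun v : V => dep (top v)).bddAbove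
        refine ⟨b, ?_⟩
        rintro _ ⟨t, ht, rfl⟩
        have hne : (Y ∩ below par top t).Nonempty := by
          rw [nonempty_iff_ne_empty]
          intro h
          have ht' : η + 2 ≤ (Y ∩ below par top t).ncard := ht
          rw [h, ncard_empty] at ht'
          omega
        obtain ⟨v, -, m, rfl⟩ := hne
        have h1 := hb (mem_range_self v)
        rcases dep_iterate_le hpar m (top v) with h | h
        · rw [h]; exact h1
        · exact h.le.trans h1
      obtain ⟨t, ht, htmax⟩ := Nat.sSup_mem (Set.Nonempty.image dep
        (show {t | η + 2 ≤ (Y ∩ below par top t).ncard}.Nonempty from hex)) hbdd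
      have htmax' : ∀ s, dep t < dep s → (Y ∩ below par top s).ncard ≤ η + 1 := by
        intro s hs
        by_contra hcon
        have := le_csSup hbdd (mem_image_of_mem dep
          (show s ∈ {t | η + 2 ≤ (Y ∩ below par top t).ncard} from by
            change η + 2 ≤ _; omega))
        omega
      have ht' : η + 2 ≤ (Y ∩ below par top t).ncard := ht
      set A : Set V := {v | v ∈ U ∧ v ∈ below par top t ∧ v ∉ bag t} with hA
      set B : Set V := bag t ∩ U with hB
      set Y' : Set V := (Y \ A) ∪ B with hY'
      have hcard1 : (Y ∩ below par top t).ncard ≤ (Y ∩ A).ncard + (B ∩ Y).ncard := by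
        refine (ncard_le_ncard ?_ (toFinite _)).trans (ncard_union_le _ _)
        rintro v ⟨hvY, hvt⟩
        by_cases hv : v ∈ bag t
        · exact Or.inr ⟨⟨hv, hYU hvY⟩, hvY⟩
        · exact Or.inl ⟨hvY, hYU hvY, hvt, hv⟩
      have hcard2 : (B ∩ Y).ncard + (B \ Y).ncard = B.ncard :=
        ncard_inter_add_ncard_sdiff_eq_ncard B Y (toFinite _)
      have hcard3 : (Y ∩ A).ncard + (Y \ A).ncard = Y.ncard :=
        ncard_inter_add_ncard_sdiff_eq_ncard Y A (toFinite _)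
      have hcard4 : B.ncard ≤ η + 1 :=
        (ncard_le_ncard inter_subset_left (toFinite _)).trans (hsize t)
      have hcard5 : Y'.ncard ≤ (Y \ A).ncard + (B \ Y).ncard := by
        refine (ncard_le_ncard ?_ (toFinite _)).trans (ncard_union_le _ _)
        rintro v (hv | hv)
        · exact Or.inl hv
        · by_cases hvY : v ∈ Y
          · exact Or.inl ⟨hvY, fun h => h.2.2 hv.1⟩
          · exact Or.inr ⟨hv, hvY⟩
      have hYU' : Y' ⊆ U \ A := by
        rintro v (hv | hv)
        · exact ⟨hYU hv.1, hv.2⟩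
        · exact ⟨hv.2, fun h => h.2.2 hv.1⟩
      obtain ⟨M, hYM, hMU, hMcard, hM⟩ := ih _ (by omega) (U \ A) Y' hYU' rfl
      have hBM : B ⊆ M := subset_union_right.trans hYM
      refine ⟨M ∪ Y, subset_union_right, union_subset (hMU.trans sdiff_subset) hYU, ?_, ?_⟩
      · have h1 : (M ∪ Y).ncard ≤ M.ncard + (Y ∩ A).ncard := by
          refine (ncard_le_ncard ?_ (toFinite _)).trans (ncard_union_le _ _)
          rintro v (hv | hv)
          · exact Or.inl hv
          · by_cases hvA : v ∈ A
            · exact Or.inr ⟨hv, hvA⟩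
            · exact Or.inl (hYM (Or.inl ⟨hv, hvA⟩))
        obtain ⟨x, hx⟩ : ∃ x, n = Y'.ncard + (x + 1) := ⟨n - Y'.ncard - 1, by omega⟩
        have h2 : (Y ∩ A).ncard ≤ (η + 2) * (x + 1) := by
          have : (Y ∩ A).ncard ≤ x + 1 + (η + 1) := by omega
          nlinarith
        rw [hx, mul_add]
        omega
      · intro D hD hDU hDM
        have hDB : ∀ v ∈ D, v ∉ bag t := fun v hv hvt =>
          disjoint_left.1 hDM hv (Or.inl (hBM ⟨hvt, hDU hv⟩))
        by_cases hDA : ∃ v ∈ D, v ∈ A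
        · obtain ⟨v, hvD, -, hvt, hvb⟩ := hDA
          obtain ⟨s, rfl, hst, hvs⟩ := exists_child hvt fun h => hvb (h ▸ htop v)
          have hDs : D ⊆ below par top s := by
            refine hD.subset_of_closed hvD hvs fun x hx _ y hy hxy => ?_
            exact (mem_below_or_mem_bag_par hpar hbag hedge hx hxy).resolve_right
              fun h => hDB y hy h.2
          have hlt := (hpar s).resolve_left hst.symm
          have h1 := htmax' s hlt
          have h2 := hsize (par s)
          refine (ncard_le_ncard (t := (Y ∩ below par top s) ∪ bag (par s)) ?_
            (toFinite _)).trans ((ncard_union_le _ _).trans (by omega))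
          rintro m ⟨hm, x, hx, hxm⟩
          rcases mem_below_or_mem_bag_par hpar hbag hedge (hDs hx) hxm with h | h
          · by_cases hmb : m ∈ bag (par s)
            · exact Or.inr hmb
            · refine Or.inl ⟨hm.resolve_left fun hmM => (hMU hmM).2 ⟨(hMU hmM).1, ?_, hmb⟩, h⟩
              exact below_subset_of_iterate (n := 1) rfl h
          · exact Or.inr h.2
        · push Not at hDA
          refine (ncard_le_ncard ?_ (toFinite _)).trans
            (hM D hD (fun v hv => ⟨hDU hv, hDA v hv⟩) (hDM.mono_right subset_union_left))
          rintro m ⟨hm, x, hx, hxm⟩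
          refine ⟨?_, x, hx, hxm⟩
          rcases hm with hm | hm
          · exact hm
          · by_cases hmA : m ∈ A
            · exfalso
              rcases mem_bag_of_adj_below hpar hbag hedge hmA.2.1 hxm.symm with h | h
              · exact hDB x hx h
              · exact hDA x hx ⟨hDU hx, h, hDB x hx⟩
            · exact hYM (Or.inl ⟨hm, hmA⟩)
    · push Not at hex
      refine ⟨Y, Subset.rfl, hYU, by nlinarith, fun D hD _ _ => ?_⟩
      obtain ⟨v, hv⟩ := hD.1
      obtain ⟨m, hm⟩ := exists_root hpar (top v)
      have hDs : D ⊆ below par top (par^[m] (top v)) := by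
        refine hD.subset_of_closed hv ⟨m, rfl⟩ fun x hx _ y _ hxy => ?_
        exact (mem_below_or_mem_bag_par hpar hbag hedge hx hxy).resolve_right fun h => h.1 hm
      have := hex (par^[m] (top v))
      refine (ncard_le_ncard (t := Y ∩ below par top (par^[m] (top v))) ?_ (toFinite _)).trans
        (by omega)
      rintro y ⟨hy, x, hx, hxy⟩
      exact ⟨hy, (mem_below_or_mem_bag_par hpar hbag hedge (hDs hx) hxy).resolve_right
        fun h => h.1 hm⟩

end Marking

/-- A set `Y` of vertices of a graph of width `η` extends to a set `M` of at most `(η + 2)|Y|`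
vertices such that connected sets avoiding `M` have at most `2η + 2` neighbours in `M`. -/
theorem exists_marking {V : Type} [Finite V] {G : SimpleGraph V} {η : ℕ}
    (h : ForestWidthLE G η) (Y : Set V) : ∃ M, Y ⊆ M ∧ M.ncard ≤ (η + 2) * Y.ncard ∧
      ∀ D, SetConn G D → Disjoint D M →
        {m | m ∈ M ∧ ∃ v ∈ D, G.Adj v m}.ncard ≤ 2 * η + 2 := by
  obtain ⟨ι, par, dep, bag, top, hpar, htop, hbag, hedge, hsize⟩ := h
  obtain ⟨M, h1, -, h2, h3⟩ := exists_marking_aux hpar hbag htop hedge (fun i => (hsize i).2) _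
    univ Y (subset_univ _) rfl
  exact ⟨M, h1, h2, fun D hD => h3 D hD (subset_univ _)⟩

/-- A family of disjoint connected sets, any two of them joined by an edge. -/
def IsCliqueModel {V : Type} (G : SimpleGraph V) (𝒞 : Finset (Set V)) : Prop :=
  (∀ C ∈ 𝒞, SetConn G C) ∧
    ∀ C ∈ 𝒞, ∀ D ∈ 𝒞, C ≠ D → Disjoint C D ∧ ∃ x ∈ C, ∃ y ∈ D, G.Adj x y

section Separator

variable {V : Type} {G : SimpleGraph V}

/-- A connected subset of `B` of size at most `n` containing `v` and having a neighbour in every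
member of `𝒮`. -/
def IsHit (G : SimpleGraph V) (B : Set V) (𝒮 : Finset (Set V)) (n : ℕ) (v : V) : Prop :=
  ∃ T, SetConn G T ∧ T ⊆ B ∧ v ∈ T ∧ T.ncard ≤ n ∧ ∀ C ∈ 𝒮, ∃ x ∈ T, ∃ y ∈ C, G.Adj x y

theorem IsHit.mono {B : Set V} {𝒮 : Finset (Set V)} {m n : ℕ} {v : V} (h : IsHit G B 𝒮 m v)
    (hmn : m ≤ n) : IsHit G B 𝒮 n v := by
  obtain ⟨T, h1, h2, h3, h4, h5⟩ := h
  exact ⟨T, h1, h2, h3, h4.trans hmn, h5⟩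

/-- The vertices at distance exactly `n + 1` from some subfamily of `𝒞`. -/
def level (G : SimpleGraph V) (B : Set V) (𝒞 : Finset (Set V)) (n : ℕ) : Set V :=
  {v | v ∈ B ∧ ∃ 𝒮 ⊆ 𝒞, IsHit G B 𝒮 (n + 1) v ∧ ¬ IsHit G B 𝒮 n v}

theorem isHit_of_connected [Finite V] {B K : Set V} {𝒞 : Finset (Set V)} {n : ℕ} (hn : 1 ≤ n)
    (hK : SetConn G K) (hKB : K ⊆ B) (hKZ : Disjoint K (level G B 𝒞 n))
    (hhit : ∀ C ∈ 𝒞, ∃ x ∈ K, ∃ y ∈ C, G.Adj x y) {𝒮 : Finset (Set V)} (h𝒮 : 𝒮 ⊆ 𝒞) :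
    ∀ v ∈ K, IsHit G B 𝒮 n v := by
  classical
  induction 𝒮 using Finset.induction_on with
  | empty =>
    intro v hv
    exact ⟨{v}, setConn_singleton v, singleton_subset_iff.2 (hKB hv), mem_singleton v,
      by simpa using hn, by simp⟩
  | insert C 𝒮 hC ih =>
    obtain ⟨x, hx, y, hy, hxy⟩ := hhit C (h𝒮 (Finset.mem_insert_self _ _))
    obtain ⟨T, h1, h2, h3, h4, h5⟩ := ih ((Finset.subset_insert _ _).trans h𝒮) x hx
    have hx' : IsHit G B (insert C 𝒮) n x := by
      refine ⟨T, h1, h2, h3, h4, fun D hD => ?_⟩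
      rcases Finset.mem_insert.1 hD with rfl | hD
      · exact ⟨x, h3, y, hy, hxy⟩
      · exact h5 D hD
    refine hK.subset_of_closed (Q := {v | IsHit G B (insert C 𝒮) n v}) hx hx' ?_
    intro a ha haK b hbK hab
    obtain ⟨T, h1, h2, h3, h4, h5⟩ := ha
    have hb : IsHit G B (insert C 𝒮) (n + 1) b := by
      refine ⟨insert b T, h1.insert h3 hab, insert_subset (hKB hbK) h2, mem_insert _ _,
        (ncard_insert_le _ _).trans (by omega), fun D hD => ?_⟩
      obtain ⟨x, hx, y, hy⟩ := h5 D hD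
      exact ⟨x, mem_insert_of_mem _ hx, y, hy⟩
    by_contra hcon
    exact disjoint_left.1 hKZ hbK ⟨hKB hbK, _, h𝒮, hb, hcon⟩

theorem exists_small_level [Finite V] (B : Set V) {𝒞 : Finset (Set V)} (h𝒞 : 𝒞.card ≤ 4)
    {m : ℕ} (hm : Nat.card V < m * m) :
    ∃ n, 1 ≤ n ∧ n ≤ 4 * m ∧ (level G B 𝒞 n).ncard ≤ 4 * m + 1 := by
  classical
  have := Fintype.ofFinite V
  by_contra! hcon
  let Z : Finset (Set V) → ℕ → Finset V := fun 𝒮 n =>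
    Finset.univ.filter fun v => IsHit G B 𝒮 (n + 1) v ∧ ¬ IsHit G B 𝒮 n v
  have h1 : ∀ n, (level G B 𝒞 n).ncard ≤ ∑ 𝒮 ∈ 𝒞.powerset, (Z 𝒮 n).card := by
    intro n
    refine le_trans ?_ Finset.card_biUnion_le
    rw [← ncard_coe_finset]
    refine ncard_le_ncard ?_ (toFinite _)
    rintro v ⟨-, 𝒮, h𝒮, hv⟩
    simp only [Finset.coe_biUnion, mem_iUnion]
    exact ⟨𝒮, by simpa using h𝒮, by simpa [Z] using hv⟩
  have h2 : ∀ 𝒮, ∑ n ∈ Finset.Icc 1 (4 * m), (Z 𝒮 n).card ≤ Nat.card V := by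
    intro 𝒮
    rw [← Finset.card_biUnion, Nat.card_eq_fintype_card]
    · exact Finset.card_le_univ _
    · intro a _ b _ hab
      refine Finset.disjoint_left.2 fun v hva hvb => ?_
      simp only [Z, Finset.mem_filter, Finset.mem_univ, true_and] at hva hvb
      rcases lt_or_gt_of_ne hab with h | h
      · exact hvb.2 (hva.1.mono h)
      · exact hva.2 (hvb.1.mono h)
  have h3 : ∑ n ∈ Finset.Icc 1 (4 * m), (level G B 𝒞 n).ncard ≤ 16 * Nat.card V := by
    calc _ ≤ ∑ n ∈ Finset.Icc 1 (4 * m), ∑ 𝒮 ∈ 𝒞.powerset, (Z 𝒮 n).card :=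
          Finset.sum_le_sum fun n _ => h1 n
      _ = ∑ 𝒮 ∈ 𝒞.powerset, ∑ n ∈ Finset.Icc 1 (4 * m), (Z 𝒮 n).card := Finset.sum_comm
      _ ≤ ∑ 𝒮 ∈ 𝒞.powerset, Nat.card V := Finset.sum_le_sum fun 𝒮 _ => h2 𝒮
      _ = 2 ^ 𝒞.card * Nat.card V := by simp
      _ ≤ 2 ^ 4 * Nat.card V :=
          Nat.mul_le_mul_right _ (Nat.pow_le_pow_right (by norm_num) h𝒞)
      _ = 16 * Nat.card V := by norm_num
  have h4 : ∑ n ∈ Finset.Icc 1 (4 * m), (4 * m + 1) ≤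
      ∑ n ∈ Finset.Icc 1 (4 * m), (level G B 𝒞 n).ncard := by
    refine Finset.sum_le_sum fun n hn => ?_
    rw [Finset.mem_Icc] at hn
    exact (hcon n hn.1 hn.2).le
  simp only [Finset.sum_const, Nat.card_Icc, smul_eq_mul, Nat.add_sub_cancel] at h4
  nlinarith

/-- The states of the separator search. -/
structure IsState (G : SimpleGraph V) (W : Set V) (R : ℕ) (𝒞 : Finset (Set V)) (X B : Set V) :
    Prop where
  model : IsCliqueModel G 𝒞
  subset : ∀ x ∈ X, ∃ C ∈ 𝒞, x ∈ C
  card_le : ∀ C ∈ 𝒞, (X ∩ C).ncard ≤ R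
  disj : ∀ C ∈ 𝒞, Disjoint C B
  conn : SetConn G B
  nbr : ∀ x ∈ B, ∀ y, G.Adj x y → y ∈ B ∨ y ∈ X
  big : W.ncard < 2 * (B ∩ W).ncard

theorem exists_mem_of_big [Finite V] {W B B' : Set V} (h : W.ncard < 2 * (B ∩ W).ncard)
    (h' : W.ncard < 2 * (B' ∩ W).ncard) : ∃ x ∈ B, x ∈ B' := by
  by_contra! hcon
  have hd : Disjoint (B ∩ W) (B' ∩ W) :=
    disjoint_left.2 fun x hx hx' => hcon x hx.1 hx'.1
  have h1 := ncard_union_eq hd (toFinite _) (toFinite _)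
  have h2 : ((B ∩ W) ∪ (B' ∩ W)).ncard ≤ W.ncard :=
    ncard_le_ncard (union_subset inter_subset_right inter_subset_right) (toFinite _)
  omega

theorem IsState.subset_of_big [Finite V] {W X B B' : Set V} {R : ℕ} {𝒞 : Finset (Set V)}
    (h : IsState G W R 𝒞 X B) (hB' : SetConn G B') (hX : Disjoint B' X)
    (hbig : W.ncard < 2 * (B' ∩ W).ncard) : B' ⊆ B := by
  obtain ⟨x, hx, hx'⟩ := exists_mem_of_big h.big hbig
  exact hB'.subset_of_closed hx' hx fun a ha _ b hb hab =>
    (h.nbr a ha b hab).resolve_right (disjoint_left.1 hX hb)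

theorem IsState.card_X_le [Finite V] {W X B : Set V} {R : ℕ} {𝒞 : Finset (Set V)}
    (h : IsState G W R 𝒞 X B) : X.ncard ≤ 𝒞.card * R := by
  classical
  have h1 : X ⊆ ⋃ C ∈ 𝒞, X ∩ C := fun x hx => by
    obtain ⟨C, hC, hxC⟩ := h.subset x hx
    exact mem_biUnion hC ⟨hx, hxC⟩
  refine (ncard_le_ncard h1 (toFinite _)).trans ((Finset.set_ncard_biUnion_le 𝒞 _).trans ?_)
  rw [← smul_eq_mul]
  exact Finset.sum_le_card_nsmul _ _ _ h.card_le

theorem IsState.drop {W X B : Set V} {R : ℕ} {𝒞 : Finset (Set V)} [DecidableEq (Set V)]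
    [Finite V] (h : IsState G W R 𝒞 X B) {C : Set V}
    (hnot : ∀ x ∈ B, ∀ y ∈ C, ¬ G.Adj x y) : IsState G W R (𝒞.erase C) (X \ C) B where
  model := ⟨fun D hD => h.model.1 D (Finset.mem_of_mem_erase hD), fun D hD E hE =>
    h.model.2 D (Finset.mem_of_mem_erase hD) E (Finset.mem_of_mem_erase hE)⟩
  subset x hx := by
    obtain ⟨D, hD, hxD⟩ := h.subset x hx.1
    exact ⟨D, Finset.mem_erase.2 ⟨fun hDC => hx.2 (hDC ▸ hxD), hD⟩, hxD⟩
  card_le D hD := (ncard_le_ncard (inter_subset_inter_left _ sdiff_subset) (toFinite _)).trans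
    (h.card_le D (Finset.mem_of_mem_erase hD))
  disj D hD := h.disj D (Finset.mem_of_mem_erase hD)
  conn := h.conn
  nbr x hx y hxy := (h.nbr x hx y hxy).imp id fun hy => ⟨hy, fun hyC => hnot x hx y hyC hxy⟩
  big := h.big

theorem IsState.add {W X B : Set V} {R : ℕ} {𝒞 : Finset (Set V)} [DecidableEq (Set V)]
    [Finite V] (h : IsState G W R 𝒞 X B) {T B' : Set V} (hT : SetConn G T) (hTB : T ⊆ B)
    (hTR : T.ncard ≤ R) (hhit : ∀ C ∈ 𝒞, ∃ x ∈ T, ∃ y ∈ C, G.Adj x y)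
    (hB' : SetConn G B') (hdisj : Disjoint B' (X ∪ T))
    (hnbr : ∀ x ∈ B', ∀ y, G.Adj x y → y ∈ B' ∨ y ∈ X ∪ T)
    (hbig : W.ncard < 2 * (B' ∩ W).ncard) : IsState G W R (insert T 𝒞) (X ∪ T) B' := by
  have hsub := h.subset_of_big hB' (hdisj.mono_right subset_union_left) hbig
  have hCT : ∀ C ∈ 𝒞, Disjoint C T := fun C hC => (h.disj C hC).mono_right hTB
  refine ⟨⟨?_, ?_⟩, ?_, ?_, ?_, hB', hnbr, hbig⟩
  · intro C hC
    rcases Finset.mem_insert.1 hC with rfl | hC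
    · exact hT
    · exact h.model.1 C hC
  · intro C hC D hD hCD
    rcases Finset.mem_insert.1 hC with rfl | hC' <;> rcases Finset.mem_insert.1 hD with rfl | hD'
    · exact absurd rfl hCD
    · exact ⟨(hCT D hD').symm, hhit D hD'⟩
    · obtain ⟨x, hx, y, hy, hxy⟩ := hhit C hC'
      exact ⟨hCT C hC', y, hy, x, hx, hxy.symm⟩
    · exact h.model.2 C hC' D hD' hCD
  · rintro x (hx | hx)
    · obtain ⟨C, hC, hxC⟩ := h.subset x hx
      exact ⟨C, Finset.mem_insert_of_mem hC, hxC⟩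
    · exact ⟨T, Finset.mem_insert_self _ _, hx⟩
  · intro C hC
    rcases Finset.mem_insert.1 hC with rfl | hC
    · exact (ncard_le_ncard inter_subset_right (toFinite _)).trans hTR
    · refine (ncard_le_ncard ?_ (toFinite _)).trans (h.card_le C hC)
      rintro x ⟨hx | hx, hxC⟩
      · exact ⟨hx, hxC⟩
      · exact absurd hx (disjoint_left.1 (hCT C hC) hxC)
  · intro C hC
    rcases Finset.mem_insert.1 hC with rfl | hC
    · exact (hdisj.mono_right subset_union_right).symm
    · exact (h.disj C hC).mono_right hsub

theorem IsState.grow {W X B : Set V} {R : ℕ} {𝒞 : Finset (Set V)} [DecidableEq (Set V)]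
    [Finite V] (h : IsState G W R 𝒞 X B) {Z B' C : Set V} (hZR : Z.ncard ≤ R)
    (hB' : SetConn G B') (hdisj : Disjoint B' (X ∪ Z))
    (hnbr : ∀ x ∈ B', ∀ y, G.Adj x y → y ∈ B' ∨ y ∈ X ∪ Z)
    (hbig : W.ncard < 2 * (B' ∩ W).ncard) (hC : C ∈ 𝒞)
    (hnot : ∀ x ∈ B', ∀ y ∈ C, ¬ G.Adj x y) (hex : ∃ x ∈ B, ∃ y ∈ C, G.Adj x y) :
    ∃ C' X' B'', IsState G W R (insert C' (𝒞.erase C)) X' B'' ∧ B''.ncard < B.ncard := by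
  have hsub := h.subset_of_big hB' (hdisj.mono_right subset_union_left) hbig
  obtain ⟨c, hc⟩ := (h.model.1 C hC).1
  obtain ⟨b, hb⟩ := hB'.1
  set U : Set V := C ∪ (B \ B') with hU
  set C' : Set V := reach G U c with hC'
  have hCC' : C ⊆ C' := (h.model.1 C hC).subset_reach subset_union_left hc
  have hC'U : C' ⊆ U := reach_subset (Or.inl hc)
  have hC'B' : Disjoint C' B' := disjoint_left.2 fun x hx hx' => by
    rcases hC'U hx with h1 | h1
    · exact disjoint_left.1 (h.disj C hC) h1 (hsub hx')
    · exact h1.2 hx'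
  have hC'D : ∀ D ∈ 𝒞, D ≠ C → Disjoint C' D := fun D hD hne => disjoint_left.2 fun x hx hx' => by
    rcases hC'U hx with h1 | h1
    · exact disjoint_left.1 (h.model.2 C hC D hD hne.symm).1 h1 hx'
    · exact disjoint_left.1 (h.disj D hD) hx' h1.1
  set B'' : Set V := reach G (B \ C') b with hB''
  have hbB : b ∈ B \ C' := ⟨hsub hb, disjoint_right.1 hC'B' hb⟩
  have hB''B : B'' ⊆ B \ C' := reach_subset hbB
  have hB'B'' : B' ⊆ B'' :=
    hB'.subset_reach (U := B \ C') (fun x hx => ⟨hsub hx, disjoint_right.1 hC'B' hx⟩) hb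
  refine ⟨C', (X \ C) ∪ (Z ∩ C'), B'', ⟨⟨?_, ?_⟩, ?_, ?_, ?_, setConn_reach _ _, ?_, ?_⟩, ?_⟩
  · intro D hD
    rcases Finset.mem_insert.1 hD with rfl | hD
    · exact setConn_reach _ _
    · exact h.model.1 D (Finset.mem_of_mem_erase hD)
  · have key : ∀ D ∈ 𝒞.erase C, Disjoint C' D ∧ ∃ x ∈ C', ∃ y ∈ D, G.Adj x y := by
      intro D hD
      obtain ⟨hne, hD⟩ := Finset.mem_erase.1 hD
      obtain ⟨x, hx, y, hy, hxy⟩ := (h.model.2 C hC D hD hne.symm).2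
      exact ⟨hC'D D hD hne, x, hCC' hx, y, hy, hxy⟩
    intro D hD E hE hDE
    rcases Finset.mem_insert.1 hD with rfl | hD <;> rcases Finset.mem_insert.1 hE with rfl | hE
    · exact absurd rfl hDE
    · exact key E hE
    · obtain ⟨h1, x, hx, y, hy, hxy⟩ := key D hD
      exact ⟨h1.symm, y, hy, x, hx, hxy.symm⟩
    · exact h.model.2 D (Finset.mem_of_mem_erase hD) E (Finset.mem_of_mem_erase hE) hDE
  · rintro x (hx | hx)
    · obtain ⟨D, hD, hxD⟩ := h.subset x hx.1
      exact ⟨D, Finset.mem_insert_of_mem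
        (Finset.mem_erase.2 ⟨fun hDC => hx.2 (hDC ▸ hxD), hD⟩), hxD⟩
    · exact ⟨C', Finset.mem_insert_self _ _, hx.2⟩
  · intro D hD
    rcases Finset.mem_insert.1 hD with rfl | hD
    · refine (ncard_le_ncard ?_ (toFinite _)).trans hZR
      rintro x ⟨hx | hx, hxC'⟩
      · obtain ⟨D, hD, hxD⟩ := h.subset x hx.1
        have hne : D ≠ C := fun hDC => hx.2 (hDC ▸ hxD)
        exact absurd hxD (disjoint_left.1 (hC'D D hD hne) hxC')
      · exact hx.1
    · obtain ⟨hne, hD⟩ := Finset.mem_erase.1 hD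
      refine (ncard_le_ncard ?_ (toFinite _)).trans (h.card_le D hD)
      rintro x ⟨hx | hx, hxD⟩
      · exact ⟨hx.1, hxD⟩
      · exact absurd hxD (disjoint_left.1 (hC'D D hD hne) hx.2)
  · intro D hD
    rcases Finset.mem_insert.1 hD with rfl | hD
    · exact disjoint_right.2 fun x hx => (hB''B hx).2
    · exact (h.disj D (Finset.mem_of_mem_erase hD)).mono_right (hB''B.trans sdiff_subset)
  · intro x hx y hxy
    obtain ⟨hxB, hxC'⟩ := hB''B hx
    have hxU : x ∉ B' → ∀ z ∈ C', ¬ G.Adj z x := fun hxB' z hz hzx =>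
      hxC' (reach_closed hz (Or.inr ⟨hxB, hxB'⟩) hzx)
    rcases h.nbr x hxB y hxy with hyB | hyX
    · by_cases hyC' : y ∈ C'
      · right; right
        have hxB' : x ∈ B' := by
          by_contra hxB'
          exact hxU hxB' y hyC' hxy.symm
        rcases hnbr x hxB' y hxy with h1 | h1 | h1
        · exact absurd h1 (disjoint_left.1 hC'B' hyC')
        · obtain ⟨D, hD, hyD⟩ := h.subset y h1
          exact absurd hyB (disjoint_left.1 (h.disj D hD) hyD)
        · exact ⟨h1, hyC'⟩
      · exact Or.inl (reach_closed hx ⟨hyB, hyC'⟩ hxy)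
    · right; left
      refine ⟨hyX, fun hyC => ?_⟩
      by_cases hxB' : x ∈ B'
      · exact hnot x hxB' y hyC hxy
      · exact hxU hxB' y (hCC' hyC) hxy.symm
  · have : (B' ∩ W).ncard ≤ (B'' ∩ W).ncard :=
      ncard_le_ncard (inter_subset_inter_left _ hB'B'') (toFinite _)
    omega
  · refine ncard_lt_ncard ⟨hB''B.trans sdiff_subset, fun hBB'' => ?_⟩ (toFinite _)
    obtain ⟨x, hx, y, hy, hxy⟩ := hex
    have hxB' : x ∉ B' := fun hx' => hnot x hx' y hy hxy
    exact (hB''B (hBB'' hx)).2 (reach_closed (hCC' hy) (Or.inr ⟨hx, hxB'⟩) hxy.symm)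

end Separator

/-- The Alon–Seymour–Thomas separator theorem for graphs without a `K₅` minor. -/
theorem exists_separator {V : Type} [Finite V] {G : SimpleGraph V}
    (hK5 : ∀ 𝒞 : Finset (Set V), IsCliqueModel G 𝒞 → 𝒞.card ≤ 4) (W : Set V) {m : ℕ}
    (hm : Nat.card V < m * m) :
    ∃ S : Set V, S.ncard ≤ 5 * (4 * m + 1) ∧
      ∀ K, SetConn G K → Disjoint K S → 2 * (K ∩ W).ncard ≤ W.ncard := by
  classical
  by_contra! hcon
  have hcomp : ∀ S : Set V, S.ncard ≤ 5 * (4 * m + 1) → ∃ B, SetConn G B ∧ Disjoint B S ∧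
      (∀ x ∈ B, ∀ y, G.Adj x y → y ∈ B ∨ y ∈ S) ∧ W.ncard < 2 * (B ∩ W).ncard := by
    intro S hS
    obtain ⟨K, hK, hKS, hKW⟩ := hcon S hS
    obtain ⟨v, hv⟩ := hK.1
    have hKSc : K ⊆ Sᶜ := hKS.subset_compl_right
    refine ⟨reach G Sᶜ v, setConn_reach _ _, ?_, ?_, ?_⟩
    · exact disjoint_left.2 (reach_subset (hKSc hv))
    · intro x hx y hxy
      by_cases hy : y ∈ S
      · exact Or.inr hy
      · exact Or.inl (reach_closed hx hy hxy)
    · have : (K ∩ W).ncard ≤ (reach G Sᶜ v ∩ W).ncard :=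
        ncard_le_ncard (inter_subset_inter_left _ (hK.subset_reach hKSc hv)) (toFinite _)
      omega
  suffices ∀ n 𝒞 X B, IsState G W (4 * m + 1) 𝒞 X B → 2 * B.ncard + 𝒞.card = n → False by
    obtain ⟨B, h1, -, h3, h4⟩ := hcomp ∅ (by simp)
    refine this _ ∅ ∅ B ⟨⟨by simp, by simp⟩, by simp, by simp, by simp, h1, h3, h4⟩ rfl
  intro n
  induction n using Nat.strong_induction_on with
  | _ n ih =>
    intro 𝒞 X B hst hn
    have h𝒞 := hK5 𝒞 hst.model
    have hX : X.ncard ≤ 4 * (4 * m + 1) := hst.card_X_le.trans (Nat.mul_le_mul_right _ h𝒞)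
    by_cases hdrop : ∃ C ∈ 𝒞, ∀ x ∈ B, ∀ y ∈ C, ¬ G.Adj x y
    · obtain ⟨C, hC, hnot⟩ := hdrop
      have := Finset.card_erase_lt_of_mem hC
      exact ih _ (by omega) _ _ _ (hst.drop hnot) rfl
    push Not at hdrop
    by_cases hadd : ∃ T, SetConn G T ∧ T ⊆ B ∧ T.ncard ≤ 4 * m + 1 ∧
        ∀ C ∈ 𝒞, ∃ x ∈ T, ∃ y ∈ C, G.Adj x y
    · obtain ⟨T, hT, hTB, hTR, hhit⟩ := hadd
      obtain ⟨B', h1, h2, h3, h4⟩ := hcomp (X ∪ T) ((ncard_union_le _ _).trans (by omega))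
      have hsub := hst.subset_of_big h1 (h2.mono_right subset_union_left) h4
      have hlt : B'.ncard < B.ncard := by
        refine ncard_lt_ncard ⟨hsub, fun hBB' => ?_⟩ (toFinite _)
        obtain ⟨x, hx⟩ := hT.1
        exact disjoint_left.1 h2 (hBB' (hTB hx)) (Or.inr hx)
      have := Finset.card_insert_le T 𝒞
      exact ih _ (by omega) _ _ _ (hst.add hT hTB hTR hhit h1 h2 h3 h4) rfl
    · obtain ⟨l, hl1, hl2, hl3⟩ := exists_small_level (G := G) B h𝒞 hm
      obtain ⟨B', h1, h2, h3, h4⟩ := hcomp (X ∪ level G B 𝒞 l)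
        ((ncard_union_le _ _).trans (by omega))
      have hsub := hst.subset_of_big h1 (h2.mono_right subset_union_left) h4
      obtain ⟨C, hC, hnot⟩ : ∃ C ∈ 𝒞, ∀ x ∈ B', ∀ y ∈ C, ¬ G.Adj x y := by
        by_contra! hhit
        obtain ⟨v, hv⟩ := h1.1
        obtain ⟨T, k1, k2, -, k3, k4⟩ := isHit_of_connected hl1 h1 hsub
          (h2.mono_right subset_union_right) hhit Finset.Subset.rfl v hv
        exact hadd ⟨T, k1, k2, by omega, k4⟩
      obtain ⟨C', X', B'', k1, k2⟩ := hst.grow hl3 h1 h2 h3 h4 hC hnot (hdrop C hC)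
      have := Finset.card_insert_le C' (𝒞.erase C)
      have := Finset.card_erase_lt_of_mem hC
      exact ih _ (by omega) _ _ _ k1 rfl

section Contraction

variable {V : Type} {G : SimpleGraph V} {M : Set V}

open Classical in
/-- The singleton of a vertex of `M`, or the component of `G ∖ M` containing a vertex outside. -/
noncomputable def cell (G : SimpleGraph V) (M : Set V) (v : V) : Set V :=
  if v ∈ M then {v} else reach G Mᶜ v

theorem cell_of_mem {v : V} (hv : v ∈ M) : cell G M v = {v} := if_pos hv

theorem cell_of_notMem {v : V} (hv : v ∉ M) : cell G M v = reach G Mᶜ v := if_neg hv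

theorem mem_cell_self (v : V) : v ∈ cell G M v := by
  by_cases hv : v ∈ M
  · simp [cell_of_mem hv]
  · rw [cell_of_notMem hv]; exact mem_reach_self _ _

theorem setConn_cell (v : V) : SetConn G (cell G M v) := by
  by_cases hv : v ∈ M
  · rw [cell_of_mem hv]; exact setConn_singleton v
  · rw [cell_of_notMem hv]; exact setConn_reach _ _

theorem cell_eq_of_mem {v w : V} (h : w ∈ cell G M v) : cell G M w = cell G M v := by
  by_cases hv : v ∈ M
  · rw [cell_of_mem hv, mem_singleton_iff] at h
    rw [h]
  · rw [cell_of_notMem hv] at h ⊢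
    have hw : w ∉ M := reach_subset (U := Mᶜ) hv h
    rw [cell_of_notMem hw]
    exact reach_eq_of_mem hv h

/-- The graph obtained by contracting the components of `G ∖ M`. -/
def contraction (G : SimpleGraph V) (M : Set V) : SimpleGraph (range (cell G M)) where
  Adj A B := A ≠ B ∧ ∃ a ∈ A.1, ∃ b ∈ B.1, G.Adj a b
  symm := ⟨fun _ _ ⟨h, a, ha, b, hb, hab⟩ => ⟨h.symm, b, hb, a, ha, hab.symm⟩⟩
  loopless := ⟨fun _ h => h.1 rfl⟩

/-- The projection onto the contraction. -/
noncomputable def toCell (G : SimpleGraph V) (M : Set V) : V → range (cell G M) :=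
  rangeFactorization (cell G M)

theorem toCell_eq_iff {v : V} {A : range (cell G M)} : toCell G M v = A ↔ v ∈ A.1 := by
  constructor
  · rintro rfl; exact mem_cell_self v
  · obtain ⟨_, w, rfl⟩ := A
    intro h
    exact Subtype.ext (cell_eq_of_mem h)

theorem toCell_surjective : Function.Surjective (toCell G M) := rangeFactorization_surjective

theorem toCell_injOn : InjOn (toCell G M) M := by
  intro a ha b hb hab
  have h := congrArg Subtype.val hab
  change cell G M a = cell G M b at h
  rw [cell_of_mem ha, cell_of_mem hb] at h
  exact singleton_injective h

theorem setConn_preimage_toCell {C : Set (range (cell G M))} (hC : SetConn (contraction G M) C) :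
    SetConn G (toCell G M ⁻¹' C) := by
  obtain ⟨A, hA⟩ := hC.1
  obtain ⟨v, rfl⟩ := toCell_surjective A
  have hsub : ∀ B ∈ C, B.1 ⊆ toCell G M ⁻¹' C := fun B hB b hb => by
    rw [mem_preimage, toCell_eq_iff.2 hb]; exact hB
  have hconn : ∀ B : range (cell G M), SetConn G B.1 := by
    rintro ⟨_, w, rfl⟩; exact setConn_cell w
  have key : C ⊆ {B | B.1 ⊆ reach G (toCell G M ⁻¹' C) v} := by
    refine hC.subset_of_closed hA ((hconn _).subset_reach (hsub _ hA) (mem_cell_self v)) ?_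
    rintro A hA hAC B hBC ⟨-, a, ha, b, hb, hab⟩ w hw
    have hb' := reach_closed (hA ha) (hsub B hBC hb) hab
    rw [← reach_eq_of_mem (show v ∈ toCell G M ⁻¹' C from ‹_›) hb']
    exact (hconn B).subset_reach (hsub B hBC) hb hw
  have heq : toCell G M ⁻¹' C = reach G (toCell G M ⁻¹' C) v :=
    Subset.antisymm (fun w hw => key hw (mem_cell_self w)) (reach_subset hA)
  rw [heq]
  exact setConn_reach _ _

theorem SetConn.image_toCell {K : Set V} (hK : SetConn G K) :
    SetConn (contraction G M) (toCell G M '' K) := by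
  obtain ⟨v, hv⟩ := hK.1
  refine .of_base (mem_image_of_mem _ hv) ?_
  rintro _ ⟨w, hw, rfl⟩
  have h := hK.2 v hv w hw
  clear hw
  induction h with
  | refl => exact .refl
  | @tail b c _ hbc ih =>
    by_cases heq : toCell G M b = toCell G M c
    · rw [← heq]; exact ih
    · exact ih.tail ⟨⟨heq, b, mem_cell_self b, c, mem_cell_self c, hbc.1⟩,
        mem_image_of_mem _ hbc.2⟩

theorem contraction_card_le_four
    (hK5 : ∀ 𝒞 : Finset (Set V), IsCliqueModel G 𝒞 → 𝒞.card ≤ 4)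
    (𝒞 : Finset (Set (range (cell G M)))) (h𝒞 : IsCliqueModel (contraction G M) 𝒞) :
    𝒞.card ≤ 4 := by
  classical
  rw [← Finset.card_image_of_injective 𝒞 (preimage_injective.2 (toCell_surjective (G := G)))]
  refine hK5 _ ⟨?_, ?_⟩
  · intro _ hC'
    obtain ⟨C, hC, rfl⟩ := Finset.mem_image.1 hC'
    exact setConn_preimage_toCell (h𝒞.1 C hC)
  · intro _ hC' _ hD' hne
    obtain ⟨C, hC, rfl⟩ := Finset.mem_image.1 hC'
    obtain ⟨D, hD, rfl⟩ := Finset.mem_image.1 hD'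
    obtain ⟨h1, A, hA, B, hB, -, a, ha, b, hb, hab⟩ := h𝒞.2 C hC D hD fun h => hne (h ▸ rfl)
    exact ⟨h1.preimage _, a, by rw [mem_preimage, toCell_eq_iff.2 ha]; exact hA, b,
      by rw [mem_preimage, toCell_eq_iff.2 hb]; exact hB, hab⟩

theorem card_cells_le [Finite V] (hconn : SetConn G univ) (hM : M.Nonempty)
    {d : ℕ} (hdeg : ∀ v, {w | G.Adj v w}.ncard ≤ d) :
    Nat.card (range (cell G M)) ≤ M.ncard * (d + 1) := by
  have h1 : range (cell G M) ⊆ cell G M '' ⋃ m ∈ M, insert m {w | G.Adj m w} := by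
    rintro _ ⟨v, rfl⟩
    by_contra hcon
    have hnot : ∀ x ∈ cell G M v, x ∉ M ∧ ∀ m ∈ M, ¬ G.Adj m x := by
      intro x hx
      constructor
      · intro hxM
        exact hcon ⟨x, mem_biUnion hxM (mem_insert _ _), cell_eq_of_mem hx⟩
      · intro m hm hmx
        exact hcon ⟨x, mem_biUnion hm (mem_insert_of_mem _ hmx), cell_eq_of_mem hx⟩
    have hsub : univ ⊆ cell G M v := by
      refine hconn.subset_of_closed (mem_univ v) (mem_cell_self v) fun x hx _ y _ hxy => ?_
      have hy : y ∉ M := fun hy => (hnot x hx).2 y hy hxy.symm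
      have hv : v ∉ M := (hnot v (mem_cell_self v)).1
      rw [cell_of_notMem hv] at hx ⊢
      exact reach_closed hx hy hxy
    obtain ⟨m, hm⟩ := hM
    exact (hnot m (hsub (mem_univ m))).1 hm
  rw [Nat.card_coe_set_eq]
  refine (ncard_le_ncard h1 (toFinite _)).trans ((ncard_image_le (toFinite _)).trans ?_)
  exact (ncard_biUnion_le_mul (toFinite M) fun m _ => ⟨toFinite _,
    (ncard_insert_le _ _).trans (Nat.succ_le_succ (hdeg m))⟩).2

end Contraction

theorem exists_marking_of_compl {V : Type} [Finite V] {G : SimpleGraph V} {η d : ℕ} {Y : Set V}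
    (hdeg : ∀ v, {w | G.Adj v w}.ncard ≤ d) (h : ForestWidthLE (G.induce Yᶜ) η) :
    ∃ M, Y ⊆ M ∧ M.ncard ≤ (d * (η + 2) + 1) * Y.ncard ∧
      ∀ D, SetConn G D → Disjoint D M → {m | m ∈ M ∧ ∃ v ∈ D, G.Adj v m}.ncard ≤ 2 * η + 2 := by
  obtain ⟨M, h1, h2, h3⟩ := exists_marking h (Subtype.val ⁻¹' ⋃ y ∈ Y, {w | G.Adj y w})
  refine ⟨Y ∪ Subtype.val '' M, subset_union_left, ?_, ?_⟩
  · have h4 := (ncard_biUnion_le_mul (toFinite Y) (f := fun y => {w | G.Adj y w})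
      fun y _ => ⟨toFinite _, hdeg y⟩).2
    have h5 : (Subtype.val ⁻¹' ⋃ y ∈ Y, {w | G.Adj y w} : Set (Yᶜ : Set V)).ncard ≤ Y.ncard * d := by
      rw [← ncard_image_of_injective _ Subtype.val_injective]
      exact (ncard_le_ncard (image_preimage_subset _ _) (toFinite _)).trans h4
    have h6 := Nat.mul_le_mul_left (η + 2) h5
    have h7 := ncard_union_le Y (Subtype.val '' M)
    rw [ncard_image_of_injective _ Subtype.val_injective] at h7
    nlinarith
  · intro D hD hDM
    have hDY : D ⊆ Yᶜ := (hDM.mono_right subset_union_left).subset_compl_right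
    refine le_trans ?_ (h3 _ (hD.preimage_val hDY) ?_)
    · rw [← ncard_image_of_injective _ Subtype.val_injective]
      refine ncard_le_ncard ?_ (toFinite _)
      rintro m ⟨hm, v, hv, hvm⟩
      rcases hm with hm | ⟨m, hm, rfl⟩
      · have : (⟨v, hDY hv⟩ : (Yᶜ : Set V)) ∈ M := h1 (mem_biUnion hm hvm.symm)
        exact absurd (Or.inr ⟨_, this, rfl⟩) (disjoint_left.1 hDM hv)
      · exact ⟨m, ⟨hm, ⟨v, hDY hv⟩, hv, hvm⟩, rfl⟩
    · refine disjoint_left.2 fun x hx hxM => ?_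
      exact disjoint_left.1 hDM hx (Or.inr ⟨x, hxM, rfl⟩)

/-- Balanced separators of size `O(√|Y|)` for a vertex set `Y` whose removal leaves a graph of
bounded width. -/
theorem exists_separator_of_compl {V : Type} [Finite V] {G : SimpleGraph V}
    (hK5 : ∀ 𝒞 : Finset (Set V), IsCliqueModel G 𝒞 → 𝒞.card ≤ 4) (hconn : SetConn G univ)
    {η d m : ℕ} (hdeg : ∀ v, {w | G.Adj v w}.ncard ≤ d) {Y : Set V} (hY : Y.Nonempty)
    (h : ForestWidthLE (G.induce Yᶜ) η)
    (hm : (d * (η + 2) + 1) * Y.ncard * (d + 1) < m * m) :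
    ∃ S : Set V, S.ncard ≤ 5 * (4 * m + 1) * (2 * η + 2) ∧
      ∀ K, SetConn G K → Disjoint K S → 2 * (K ∩ Y).ncard ≤ Y.ncard := by
  obtain ⟨M, hYM, hMcard, hM⟩ := exists_marking_of_compl hdeg h
  have hcells := card_cells_le hconn (hY.mono hYM) hdeg
  obtain ⟨S, hS, hsep⟩ := exists_separator (contraction_card_le_four (M := M) hK5)
    (toCell G M '' Y) (m := m)
    (lt_of_le_of_lt (hcells.trans (Nat.mul_le_mul_right _ hMcard)) hm)
  rw [(toCell_injOn.mono hYM).ncard_image] at hsep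
  refine ⟨⋃ A ∈ S, {m | m ∈ M ∧ (m ∈ A.1 ∨ ∃ v ∈ A.1, v ∉ M ∧ G.Adj v m)}, ?_, ?_⟩
  · refine (ncard_biUnion_le_mul (toFinite S) fun A _ => ⟨toFinite _, ?_⟩).2.trans
      (Nat.mul_le_mul_right _ hS)
    obtain ⟨_, w, rfl⟩ := A
    by_cases hw : w ∈ M
    · refine le_trans (ncard_le_ncard (t := {w}) ?_ (toFinite _)) (by simp)
      rintro x ⟨-, hx⟩
      simp only [cell_of_mem hw, mem_singleton_iff] at hx
      rcases hx with hx | ⟨v, rfl, hv, -⟩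
      · exact hx
      · exact absurd hw hv
    · have hdisj : Disjoint (cell G M w) M := by
        rw [cell_of_notMem hw]
        exact disjoint_left.2 (reach_subset (U := Mᶜ) hw)
      refine le_trans (ncard_le_ncard ?_ (toFinite _)) (hM _ (setConn_cell w) hdisj)
      rintro x ⟨hx, hx' | ⟨v, hv, -, hvx⟩⟩
      · exact absurd hx (disjoint_left.1 hdisj hx')
      · exact ⟨hx, v, hv, hvx⟩
  · intro K hK hKS
    by_cases hKS' : Disjoint (toCell G M '' K) S
    · refine le_trans ?_ (hsep _ hK.image_toCell hKS')
      refine Nat.mul_le_mul_left 2 ?_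
      rw [← (toCell_injOn (G := G).mono (inter_subset_right.trans hYM)).ncard_image]
      exact ncard_le_ncard (image_inter_subset _ _ _) (toFinite _)
    · obtain ⟨_, ⟨v, hv, rfl⟩, hvS⟩ := not_disjoint_iff.1 hKS'
      have hvM : v ∉ M := fun hvM =>
        disjoint_left.1 hKS hv (mem_biUnion hvS ⟨hvM, Or.inl (mem_cell_self v)⟩)
      have hsub : K ⊆ reach G Mᶜ v := by
        refine hK.subset_of_closed hv (mem_reach_self _ _) fun x hx _ y hy hxy => ?_
        refine reach_closed hx (fun hyM => ?_) hxy
        have hxM : x ∉ M := reach_subset (U := Mᶜ) hvM hx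
        rw [← cell_of_notMem hvM] at hx
        exact disjoint_left.1 hKS hy (mem_biUnion hvS ⟨hyM, Or.inr ⟨x, hx, hxM, hxy⟩⟩)
      have : K ∩ Y = ∅ := by
        ext x
        simp only [mem_inter_iff, mem_empty_iff_false, iff_false, not_and]
        exact fun hx hxY => reach_subset (U := Mᶜ) hvM (hsub hx) (hYM hxY)
      simp [this]

/-- The square grid on `ℤ × ℤ`. -/
def gridGraph : SimpleGraph (ℤ × ℤ) where
  Adj p q := p.1 = q.1 ∧ (q.2 = p.2 + 1 ∨ p.2 = q.2 + 1) ∨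
    p.2 = q.2 ∧ (q.1 = p.1 + 1 ∨ p.1 = q.1 + 1)
  symm := ⟨fun p q h => by
    rcases h with ⟨h1, h2⟩ | ⟨h1, h2⟩
    · exact Or.inl ⟨h1.symm, h2.symm⟩
    · exact Or.inr ⟨h1.symm, h2.symm⟩⟩
  loopless := ⟨fun p h => by
    rcases h with ⟨-, h | h⟩ | ⟨-, h | h⟩ <;> omega⟩

/-- The lexicographic order indicator modulo two. -/
def lexInd (a b : ℤ × ℤ) : ZMod 2 := if a.1 < b.1 ∨ (a.1 = b.1 ∧ a.2 < b.2) then 1 else 0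

/-- Indicator that the horizontal edge `cd` lies above `x`, with right end in the column of `x`. -/
def aboveInd (x c d : ℤ × ℤ) : ZMod 2 :=
  if c.1 ≠ d.1 ∧ x.1 = max c.1 d.1 ∧ x.2 < c.2 then 1 else 0

theorem lexInd_add_swap {a b : ℤ × ℤ} (h : a ≠ b) : lexInd a b + lexInd b a = 1 := by
  have h' : ¬ (a.1 = b.1 ∧ a.2 = b.2) := fun h' => h (Prod.ext h'.1 h'.2)
  unfold lexInd
  split_ifs <;> first | rfl | (exfalso; omega)

theorem aboveInd_vertical (x : ℤ × ℤ) {c d : ℤ × ℤ} (h : c.1 = d.1) : aboveInd x c d = 0 := by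
  simp [aboveInd, h]

theorem aboveInd_symm (x : ℤ × ℤ) {c d : ℤ × ℤ} (h : gridGraph.Adj c d) :
    aboveInd x c d = aboveInd x d c := by
  rcases h with ⟨h, -⟩ | ⟨h, -⟩
  · rw [aboveInd_vertical x h, aboveInd_vertical x h.symm]
  · unfold aboveInd
    split_ifs <;> first | rfl | (exfalso; omega)

theorem gridGraph_adj_cases {a b : ℤ × ℤ} (h : gridGraph.Adj a b) :
    (b = (a.1, a.2 + 1) ∨ b = (a.1 + 1, a.2)) ∨ (a = (b.1, b.2 + 1) ∨ a = (b.1 + 1, b.2)) := by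
  rcases h with ⟨h1, h2 | h2⟩ | ⟨h1, h2 | h2⟩
  · exact Or.inl (Or.inl (Prod.ext h1.symm h2))
  · exact Or.inr (Or.inl (Prod.ext h1 h2))
  · exact Or.inl (Or.inr (Prod.ext h2 h1.symm))
  · exact Or.inr (Or.inr (Prod.ext h2 h1))

/-- The parity defect of two edges `ab` and `cd`. -/
def edgeParity (a b c d : ℤ × ℤ) : ZMod 2 :=
  lexInd a c + lexInd a d + lexInd b c + lexInd b d + aboveInd a c d + aboveInd b c d +
    aboveInd c a b + aboveInd d a b

set_option maxHeartbeats 2000000 in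
theorem edgeParity_eq_zero_aux {a b c d : ℤ × ℤ} (hb : b = (a.1, a.2 + 1) ∨ b = (a.1 + 1, a.2))
    (hd : d = (c.1, c.2 + 1) ∨ d = (c.1 + 1, c.2)) (hac : a ≠ c) (had : a ≠ d) (hbc : b ≠ c)
    (hbd : b ≠ d) : edgeParity a b c d = 0 := by
  obtain ⟨a1, a2⟩ := a
  obtain ⟨c1, c2⟩ := c
  unfold edgeParity
  rcases hb with rfl | rfl <;> rcases hd with rfl | rfl <;>
    simp only [ne_eq, Prod.mk.injEq, not_and] at hac had hbc hbd <;>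
    simp only [lexInd, aboveInd, ne_eq, not_true_eq_false, false_and, if_false, add_zero] <;>
    split_ifs <;> first | rfl | (exfalso; omega)

theorem edgeParity_eq_zero {a b c d : ℤ × ℤ} (hab : gridGraph.Adj a b) (hcd : gridGraph.Adj c d)
    (hac : a ≠ c) (had : a ≠ d) (hbc : b ≠ c) (hbd : b ≠ d) : edgeParity a b c d = 0 := by
  have h1 : edgeParity a b c d = edgeParity b a c d := by
    unfold edgeParity
    rw [aboveInd_symm c hab, aboveInd_symm d hab]; ring
  have h2 : edgeParity a b c d = edgeParity a b d c := by
    unfold edgeParity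
    rw [aboveInd_symm a hcd, aboveInd_symm b hcd]; ring
  have h3 : edgeParity b a c d = edgeParity b a d c := by
    unfold edgeParity
    rw [aboveInd_symm a hcd, aboveInd_symm b hcd]; ring
  rcases gridGraph_adj_cases hab with h | h <;> rcases gridGraph_adj_cases hcd with h' | h'
  · exact edgeParity_eq_zero_aux h h' hac had hbc hbd
  · rw [h2]; exact edgeParity_eq_zero_aux h h' had hac hbd hbc
  · rw [h1]; exact edgeParity_eq_zero_aux h h' hbc hbd hac had
  · rw [h1, h3]; exact edgeParity_eq_zero_aux h h' hbd hbc had hac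

section Walks

variable {V : Type} {G : SimpleGraph V} {f : V → ℤ × ℤ}

/-- The number modulo two of edges of a walk above a point. -/
def walkAbove (f : V → ℤ × ℤ) (x : ℤ × ℤ) : ∀ {u v : V}, G.Walk u v → ZMod 2
  | _, _, .nil => 0
  | u, _, .cons (v := v) _ p => aboveInd x (f u) (f v) + walkAbove f x p

theorem edge_walk_parity (hf : Function.Injective f)
    (hadj : ∀ u v, G.Adj u v → gridGraph.Adj (f u) (f v)) {a b : V} (hab : G.Adj a b) {q q' : V}
    (Q : G.Walk q q') (ha : a ∉ Q.support) (hb : b ∉ Q.support) :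
    walkAbove f (f a) Q + walkAbove f (f b) Q + aboveInd (f q) (f a) (f b) +
      aboveInd (f q') (f a) (f b) + lexInd (f a) (f q) + lexInd (f a) (f q') +
      lexInd (f b) (f q) + lexInd (f b) (f q') = 0 := by
  induction Q with
  | nil =>
    simp only [walkAbove]
    grind
  | @cons c d e hcd Q ih =>
    simp only [Walk.support_cons, List.mem_cons, not_or] at ha hb
    have h1 := ih ha.2 hb.2
    have had : a ≠ d := fun h => ha.2 (h ▸ Q.start_mem_support)
    have hbd : b ≠ d := fun h => hb.2 (h ▸ Q.start_mem_support)
    have h2 := edgeParity_eq_zero (hadj _ _ hab) (hadj _ _ hcd) (hf.ne ha.1) (hf.ne had)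
      (hf.ne hb.1) (hf.ne hbd)
    unfold edgeParity at h2
    simp only [walkAbove]
    grind

theorem walk_walk_parity (hf : Function.Injective f)
    (hadj : ∀ u v, G.Adj u v → gridGraph.Adj (f u) (f v)) {p p' q q' : V}
    (P : G.Walk p p') (Q : G.Walk q q') (hPQ : ∀ x ∈ P.support, x ∉ Q.support) :
    walkAbove f (f p) Q + walkAbove f (f p') Q + walkAbove f (f q) P + walkAbove f (f q') P +
      lexInd (f p) (f q) + lexInd (f p) (f q') + lexInd (f p') (f q) + lexInd (f p') (f q') = 0 := by
  induction P with
  | nil =>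
    simp only [walkAbove]
    grind
  | @cons a b c hab P ih =>
    have h1 := ih fun x hx => hPQ x (by simp [hx])
    have h2 := edge_walk_parity hf hadj hab Q (hPQ a (by simp)) (hPQ b (by simp))
    simp only [walkAbove]
    grind

theorem SetConn.exists_walk {K : Set V} (hK : SetConn G K) {u w : V} (hu : u ∈ K) (hw : w ∈ K) :
    ∃ p : G.Walk u w, ∀ x ∈ p.support, x ∈ K := by
  have h := hK.2 u hu w hw
  clear hw
  induction h with
  | refl => exact ⟨.nil, by simpa using hu⟩
  | tail _ hbc ih =>
    obtain ⟨p, hp⟩ := ih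
    refine ⟨p.concat hbc.1, fun x hx => ?_⟩
    rw [Walk.support_concat, List.mem_append, List.mem_singleton] at hx
    rcases hx with hx | rfl
    · exact hp x hx
    · exact hbc.2

/-- Subgraphs of the grid have no `K₅` minor. -/
theorem IsCliqueModel.card_le_four (hf : Function.Injective f)
    (hadj : ∀ u v, G.Adj u v → gridGraph.Adj (f u) (f v)) (𝒞 : Finset (Set V))
    (h𝒞 : IsCliqueModel G 𝒞) : 𝒞.card ≤ 4 := by
  by_contra hcon
  obtain ⟨e⟩ := Function.Embedding.nonempty_of_card_le (α := Fin 5) (β := 𝒞)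
    (by rw [Fintype.card_fin, Fintype.card_coe]; omega)
  let C : Fin 5 → Set V := fun i => (e i).1
  have hne : ∀ i j, i ≠ j → C i ≠ C j := fun i j hij h => hij (e.injective (Subtype.ext h))
  have hdisj : ∀ i j, i ≠ j → Disjoint (C i) (C j) := fun i j hij =>
    (h𝒞.2 _ (e i).2 _ (e j).2 (hne i j hij)).1
  have hconn : ∀ i, SetConn G (C i) := fun i => h𝒞.1 _ (e i).2
  choose p hp using fun i => (hconn i).1
  have hwalk : ∀ i j, ∃ w : G.Walk (p i) (p j), i ≠ j → ∀ x ∈ w.support, x ∈ C i ∪ C j := by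
    intro i j
    by_cases hij : i = j
    · subst hij
      exact ⟨.nil, fun h => absurd rfl h⟩
    · obtain ⟨x, hx, y, hy, hxy⟩ := (h𝒞.2 _ (e i).2 _ (e j).2 (hne i j hij)).2
      obtain ⟨w, hw⟩ := ((hconn i).union (hconn j) hx hy (Or.inr hxy)).exists_walk
        (Or.inl (hp i)) (Or.inr (hp j))
      exact ⟨w, fun _ => hw⟩
  choose w hw using hwalk
  have hpar : ∀ i j k l : Fin 5, i ≠ j → k ≠ l → i ≠ k → i ≠ l → j ≠ k → j ≠ l →
      walkAbove f (f (p i)) (w k l) + walkAbove f (f (p j)) (w k l) +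
        walkAbove f (f (p k)) (w i j) + walkAbove f (f (p l)) (w i j) +
        lexInd (f (p i)) (f (p k)) + lexInd (f (p i)) (f (p l)) +
        lexInd (f (p j)) (f (p k)) + lexInd (f (p j)) (f (p l)) = 0 := by
    intro i j k l hij hkl hik hil hjk hjl
    refine walk_walk_parity hf hadj (w i j) (w k l) fun x hx hx' => ?_
    rcases hw i j hij x hx with h | h <;> rcases hw k l hkl x hx' with h' | h'
    · exact disjoint_left.1 (hdisj i k hik) h h'
    · exact disjoint_left.1 (hdisj i l hil) h h'
    · exact disjoint_left.1 (hdisj j k hjk) h h'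
    · exact disjoint_left.1 (hdisj j l hjl) h h'
  have hflip : ∀ i j, i ≠ j → lexInd (f (p i)) (f (p j)) + lexInd (f (p j)) (f (p i)) = 1 :=
    fun i j hij => lexInd_add_swap (hf.ne fun h =>
      disjoint_left.1 (hdisj i j hij) (hp i) (h ▸ hp j))
  have e1 := hpar 0 1 2 3 (by decide) (by decide) (by decide) (by decide) (by decide) (by decide)
  have e2 := hpar 0 1 2 4 (by decide) (by decide) (by decide) (by decide) (by decide) (by decide)
  have e3 := hpar 0 1 3 4 (by decide) (by decide) (by decide) (by decide) (by decide) (by decide)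
  have e4 := hpar 0 2 1 3 (by decide) (by decide) (by decide) (by decide) (by decide) (by decide)
  have e5 := hpar 0 2 1 4 (by decide) (by decide) (by decide) (by decide) (by decide) (by decide)
  have e6 := hpar 0 2 3 4 (by decide) (by decide) (by decide) (by decide) (by decide) (by decide)
  have e7 := hpar 0 3 1 2 (by decide) (by decide) (by decide) (by decide) (by decide) (by decide)
  have e8 := hpar 0 3 1 4 (by decide) (by decide) (by decide) (by decide) (by decide) (by decide)
  have e9 := hpar 0 3 2 4 (by decide) (by decide) (by decide) (by decide) (by decide) (by decide)
  have e10 := hpar 0 4 1 2 (by decide) (by decide) (by decide) (by decide) (by decide) (by decide)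
  have e11 := hpar 0 4 1 3 (by decide) (by decide) (by decide) (by decide) (by decide) (by decide)
  have e12 := hpar 0 4 2 3 (by decide) (by decide) (by decide) (by decide) (by decide) (by decide)
  have e13 := hpar 1 2 3 4 (by decide) (by decide) (by decide) (by decide) (by decide) (by decide)
  have e14 := hpar 1 3 2 4 (by decide) (by decide) (by decide) (by decide) (by decide) (by decide)
  have e15 := hpar 1 4 2 3 (by decide) (by decide) (by decide) (by decide) (by decide) (by decide)
  have f32 := hflip 3 2 (by decide)
  have f42 := hflip 4 2 (by decide)
  have f43 := hflip 4 3 (by decide)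
  have hcontra : (1 : ZMod 2) = 0 := by
    linear_combination (norm := (ring_nf; reduce_mod_char)) e1 + e2 + e3 + e4 + e5 + e6 + e7 + e8 +
      e9 + e10 + e11 + e12 + e13 + e14 + e15 + f32 + f42 + f43
  exact absurd hcontra (by decide)

end Walks

theorem ncard_gridNeighbors_le {V : Type} [Finite V] {G : SimpleGraph V} {f : V → ℤ × ℤ}
    (hf : Function.Injective f) (hadj : ∀ u v, G.Adj u v → gridGraph.Adj (f u) (f v)) (v : V) :
    {w | G.Adj v w}.ncard ≤ 4 := by
  classical
  rw [← ncard_image_of_injective _ hf]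
  have hsub : f '' {w | G.Adj v w} ⊆ (({((f v).1, (f v).2 + 1), ((f v).1 + 1, (f v).2),
      ((f v).1, (f v).2 - 1), ((f v).1 - 1, (f v).2)} : Finset (ℤ × ℤ)) : Set (ℤ × ℤ)) := by
    rintro _ ⟨w, hw, rfl⟩
    simp only [Finset.coe_insert, Finset.coe_singleton, mem_insert_iff, mem_singleton_iff,
      Prod.ext_iff]
    rcases hadj v w hw with ⟨h1, h2⟩ | ⟨h1, h2⟩ <;> omega
  refine (ncard_le_ncard hsub (Finset.finite_toSet _)).trans ?_
  rw [ncard_coe_finset]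
  exact Finset.card_le_four

section Recursion

/-- A constant `C` such that a subgraph `G` of the grid has treewidth at most `η + C * √|Y|`
whenever `G ∖ Y` has treewidth at most `η`. -/
noncomputable def gridConst (η : ℕ) : ℝ :=
  4 * (5 * (4 * √(((4 * (η + 2) + 1) * 5 : ℕ) : ℝ) + 5) * (2 * η + 2) + 1)

theorem gridConst_nonneg (η : ℕ) : 0 ≤ gridConst η := by
  unfold gridConst
  positivity

theorem forestWidthLE_grid_of_setConn (η n : ℕ) : ∀ {V : Type} [Finite V] {G : SimpleGraph V}
    {f : V → ℤ × ℤ}, Function.Injective f → (∀ u v, G.Adj u v → gridGraph.Adj (f u) (f v)) →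
    SetConn G univ → ∀ {Y : Set V}, Y.ncard = n → ForestWidthLE (G.induce Yᶜ) η →
    ∀ l : ℕ, (η : ℝ) + gridConst η * √(n : ℝ) ≤ l → ForestWidthLE G l := by
  induction n using Nat.strong_induction_on with
  | _ n ih =>
  intro V _ G f hf hadj hconn Y hn h l hl
  have hYfin : Y.Finite := toFinite Y
  rcases Y.eq_empty_or_nonempty with rfl | hY
  · have hl' : η ≤ l := by
      have := mul_nonneg (gridConst_nonneg η) (Real.sqrt_nonneg (n : ℝ))
      exact_mod_cast (by linarith : (η : ℝ) ≤ l)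
    refine ForestWidthLE.mono (h.comap (fun v => ⟨v, by simp⟩) (fun u v huv => ?_) fun _ _ => id) hl'
    exact congrArg Subtype.val huv
  have hnpos : 0 < n := hn ▸ (ncard_pos hYfin).2 hY
  set a : ℕ := (4 * (η + 2) + 1) * 5 with ha
  set m : ℕ := Nat.sqrt (a * n) + 1 with hm
  have hmm : (4 * (η + 2) + 1) * Y.ncard * (4 + 1) < m * m := by
    have := Nat.lt_succ_sqrt (a * n)
    rw [hn]
    calc (4 * (η + 2) + 1) * n * (4 + 1) = a * n := by rw [ha]; ring
      _ < m * m := this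
  obtain ⟨S, hS, hsep⟩ := exists_separator_of_compl (fun 𝒞 => IsCliqueModel.card_le_four hf hadj 𝒞)
    hconn (ncard_gridNeighbors_le hf hadj) hY h hmm
  set k : ℕ := ⌈(η : ℝ) + gridConst η * √((n : ℝ) / 2)⌉₊ with hk
  have hkl : k + S.ncard ≤ l := by
    have hn1 : (1 : ℝ) ≤ √(n : ℝ) := by
      rw [Real.one_le_sqrt]
      exact_mod_cast hnpos
    have hk1 : (k : ℝ) ≤ η + gridConst η * √((n : ℝ) / 2) + 1 :=
      (Nat.ceil_lt_add_one (by
        have := mul_nonneg (gridConst_nonneg η) (Real.sqrt_nonneg ((n : ℝ) / 2))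
        positivity)).le
    have hhalf : √((n : ℝ) / 2) ≤ 3 / 4 * √(n : ℝ) := by
      rw [Real.sqrt_le_left (by positivity), mul_pow, Real.sq_sqrt (by positivity)]
      have : (0 : ℝ) ≤ n := by positivity
      linarith
    have hm1 : (m : ℝ) ≤ √(a : ℝ) * √(n : ℝ) + 1 := by
      rw [hm, ← Real.sqrt_mul (by positivity)]
      push_cast
      have := Real.nat_sqrt_le_real_sqrt (a := a * n)
      push_cast at this
      linarith
    have hS1 : (S.ncard : ℝ) ≤ 5 * (4 * m + 1) * (2 * η + 2) := by exact_mod_cast hS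
    have hS2 : 5 * (4 * (m : ℝ) + 1) * (2 * η + 2) ≤
        5 * (4 * √(a : ℝ) + 5) * (2 * η + 2) * √(n : ℝ) := by
      have : 4 * (m : ℝ) + 1 ≤ (4 * √(a : ℝ) + 5) * √(n : ℝ) := by linarith
      have h2 : (0 : ℝ) ≤ 5 * (2 * η + 2) := by positivity
      nlinarith
    have hC : gridConst η = 4 * (5 * (4 * √(a : ℝ) + 5) * (2 * η + 2) + 1) := rfl
    have hC1 := mul_le_mul_of_nonneg_left hhalf (gridConst_nonneg η)
    have : (k : ℝ) + S.ncard ≤ l := by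
      refine le_trans ?_ hl
      rw [hC] at hk1 hC1 ⊢
      nlinarith
    exact_mod_cast this
  refine forestWidthLE_of_components (toFinite S) hkl fun v hv => ?_
  set K := reach G Sᶜ v with hK
  have hKconn : SetConn G K := setConn_reach _ _
  have hKS : Disjoint K S := disjoint_left.2 fun x hx hxS => reach_subset hv hx hxS
  have hKY := hsep K hKconn hKS
  have hcard : (Subtype.val ⁻¹' Y : Set K).ncard = (K ∩ Y).ncard := by
    rw [← ncard_image_of_injective _ Subtype.val_injective, Subtype.image_preimage_coe]
  refine ih (Subtype.val ⁻¹' Y : Set K).ncard (by omega) (f := f ∘ Subtype.val)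
    (hf.comp Subtype.val_injective) (fun u w huw => hadj _ _ huw) ?_ rfl ?_ k ?_
  · simpa using hKconn.preimage_val subset_rfl
  · refine h.comap (fun x => ⟨x.1.1, x.2⟩) (fun x y hxy => ?_) fun _ _ => id
    exact Subtype.ext (Subtype.ext (Subtype.mk.inj hxy))
  · refine le_trans ?_ (Nat.le_ceil _)
    have : ((Subtype.val ⁻¹' Y : Set K).ncard : ℝ) ≤ n / 2 := by
      rw [le_div_iff₀ (by norm_num)]
      exact_mod_cast (by omega : (Subtype.val ⁻¹' Y : Set K).ncard * 2 ≤ n)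
    gcongr
    exact gridConst_nonneg η

/-- If deleting `Y` from a subgraph of the grid leaves treewidth at most `η`, then the treewidth
of the subgraph is at most `η + O(√|Y|)`. -/
theorem forestWidthLE_grid {V : Type} [Finite V] {G : SimpleGraph V} {f : V → ℤ × ℤ}
    (hf : Function.Injective f) (hadj : ∀ u v, G.Adj u v → gridGraph.Adj (f u) (f v))
    {η : ℕ} {Y : Set V} (h : ForestWidthLE (G.induce Yᶜ) η) {l : ℕ}
    (hl : (η : ℝ) + gridConst η * √(Y.ncard : ℝ) ≤ l) : ForestWidthLE G l := by
  refine forestWidthLE_of_components (S := ∅) finite_empty (by simp : l + (∅ : Set V).ncard ≤ l)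
    fun v _ => ?_
  set K := reach G (∅ : Set V)ᶜ v with hK
  refine forestWidthLE_grid_of_setConn η (Subtype.val ⁻¹' Y : Set K).ncard (f := f ∘ Subtype.val)
    (hf.comp Subtype.val_injective) (fun u w huw => hadj _ _ huw) ?_ rfl ?_ l ?_
  · have := (setConn_reach (G := G) (∅ : Set V)ᶜ v).preimage_val subset_rfl
    rwa [Subtype.coe_preimage_self] at this
  · refine h.comap (fun x => ⟨x.1.1, x.2⟩) (fun x y hxy => ?_) fun _ _ => id
    exact Subtype.ext (Subtype.ext (Subtype.mk.inj hxy))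
  · refine le_trans ?_ hl
    have : (Subtype.val ⁻¹' Y : Set K).ncard ≤ Y.ncard := by
      rw [← ncard_image_of_injective _ Subtype.val_injective, Subtype.image_preimage_coe]
      exact ncard_le_ncard inter_subset_right (toFinite Y)
    gcongr
    exact gridConst_nonneg η

end Recursion

section Rectangles

theorem setConn_gridGraph_rect {a b c d : ℤ} (hab : a ≤ b) (hcd : c ≤ d) :
    SetConn gridGraph {p : ℤ × ℤ | (a ≤ p.1 ∧ p.1 ≤ b) ∧ (c ≤ p.2 ∧ p.2 ≤ d)} := by
  refine .of_base (u := (a, c)) ⟨⟨le_rfl, hab⟩, ⟨le_rfl, hcd⟩⟩ ?_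
  rintro ⟨x, y⟩ ⟨⟨hax, hxb⟩, ⟨hcy, hyd⟩⟩
  simp only at hax hxb hcy hyd
  have h1 : Relation.ReflTransGen (fun p q => gridGraph.Adj p q ∧
      q ∈ {p : ℤ × ℤ | (a ≤ p.1 ∧ p.1 ≤ b) ∧ (c ≤ p.2 ∧ p.2 ≤ d)}) (a, c) (x, c) := by
    induction x, hax using Int.leInduction with
    | base => exact .refl
    | succ x hx ih =>
      refine (ih (by omega)).tail ⟨Or.inr ⟨rfl, Or.inl rfl⟩, ⟨⟨?_, ?_⟩, ⟨?_, ?_⟩⟩⟩ <;>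
        simp only <;> omega
  refine h1.trans ?_
  clear h1
  induction y, hcy using Int.leInduction with
  | base => exact .refl
  | succ y hy ih =>
    refine (ih (by omega)).tail ⟨Or.inl ⟨rfl, Or.inl rfl⟩, ⟨⟨?_, ?_⟩, ⟨?_, ?_⟩⟩⟩ <;>
      simp only <;> omega

/-- The grid points at sup-distance at most `r` from the point `(a, b)`. -/
def cellBox (r a b : ℝ) : Set (ℤ × ℤ) := {p | |(p.1 : ℝ) - a| ≤ r ∧ |(p.2 : ℝ) - b| ≤ r}

theorem cellBox_eq (r a b : ℝ) : cellBox r a b =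
    {p : ℤ × ℤ | (⌈a - r⌉ ≤ p.1 ∧ p.1 ≤ ⌊a + r⌋) ∧ (⌈b - r⌉ ≤ p.2 ∧ p.2 ≤ ⌊b + r⌋)} := by
  ext p
  simp only [cellBox, mem_ofPred_eq, abs_le, Int.ceil_le, Int.le_floor]
  constructor
  · rintro ⟨⟨h1, h2⟩, h3, h4⟩
    refine ⟨⟨?_, ?_⟩, ?_, ?_⟩ <;> linarith
  · rintro ⟨⟨h1, h2⟩, h3, h4⟩
    refine ⟨⟨?_, ?_⟩, ?_, ?_⟩ <;> linarith

theorem round_mem_cellBox {a b a' b' : ℝ} (ha : |a - a'| ≤ 1 / 2) (hb : |b - b'| ≤ 1 / 2) :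
    (round a, round b) ∈ cellBox 1 a' b' := by
  have h1 := abs_sub_round a
  have h2 := abs_sub_round b
  rw [abs_le] at ha hb h1 h2
  simp only [cellBox, mem_ofPred_eq, abs_le]
  refine ⟨⟨?_, ?_⟩, ?_, ?_⟩ <;> linarith

theorem setConn_cellBox (a b : ℝ) : SetConn gridGraph (cellBox 1 a b) := by
  have h := round_mem_cellBox (a := a) (b := b) (a' := a) (b' := b) (by simp) (by simp)
  rw [cellBox_eq] at h ⊢
  exact setConn_gridGraph_rect (h.1.1.trans h.1.2) (h.2.1.trans h.2.2)

theorem cellBox_finite_and_ncard_le (a b : ℝ) :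
    (cellBox 7 a b).Finite ∧ (cellBox 7 a b).ncard ≤ 225 := by
  have key : ∀ a : ℝ, (Finset.Icc ⌈a - 7⌉ ⌊a + 7⌋).card ≤ 15 := by
    intro a
    rw [Int.card_Icc]
    have h1 := Int.floor_le (a + 7)
    have h2 := Int.le_ceil (a - 7)
    have : ((⌊a + 7⌋ + 1 - ⌈a - 7⌉ : ℤ) : ℝ) ≤ (15 : ℤ) := by push_cast; linarith
    have := Int.cast_le.1 this
    omega
  have heq : cellBox 7 a b =
      ((Finset.Icc ⌈a - 7⌉ ⌊a + 7⌋ ×ˢ Finset.Icc ⌈b - 7⌉ ⌊b + 7⌋ : Finset (ℤ × ℤ)) :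
        Set (ℤ × ℤ)) := by
    rw [cellBox_eq]
    ext p
    simp only [Finset.coe_product, Finset.coe_Icc, mem_prod, mem_Icc, mem_ofPred_eq]
  rw [heq]
  refine ⟨Finset.finite_toSet _, ?_⟩
  rw [ncard_coe_finset, Finset.card_product]
  exact Nat.mul_le_mul (key a) (key b)

end Rectangles

section Geometry

/-- If the points `(1 - s) a + s b` and `(1 - r) c + r d` of two segments of length at most `6`
are close, then so is some pair of endpoints. -/
theorem exists_endpoints_near {a₁ a₂ b₁ b₂ c₁ c₂ d₁ d₂ s r : ℝ} (hs : 0 ≤ s) (hs' : s ≤ 1)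
    (hr : 0 ≤ r) (hr' : r ≤ 1) (hab : (a₁ - b₁) ^ 2 + (a₂ - b₂) ^ 2 ≤ 36)
    (hcd : (c₁ - d₁) ^ 2 + (c₂ - d₂) ^ 2 ≤ 36)
    (h : ((a₁ + s * (b₁ - a₁)) - (c₁ + r * (d₁ - c₁))) ^ 2 +
      ((a₂ + s * (b₂ - a₂)) - (c₂ + r * (d₂ - c₂))) ^ 2 ≤ 18) :
    (a₁ - c₁) ^ 2 + (a₂ - c₂) ^ 2 ≤ 36 ∨ (a₁ - d₁) ^ 2 + (a₂ - d₂) ^ 2 ≤ 36 ∨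
      (b₁ - c₁) ^ 2 + (b₂ - c₂) ^ 2 ≤ 36 ∨ (b₁ - d₁) ^ 2 + (b₂ - d₂) ^ 2 ≤ 36 := by
  by_contra! hcon
  obtain ⟨hac, had, hbc, hbd⟩ := hcon
  have hs1 : 0 ≤ 1 - s := by linarith
  have hr1 : 0 ≤ 1 - r := by linarith
  have hvs : s * (1 - s) ≤ 1 / 4 := by nlinarith [sq_nonneg (s - 1 / 2)]
  have hvr : r * (1 - r) ≤ 1 / 4 := by nlinarith [sq_nonneg (r - 1 / 2)]
  have hvs' : s * (1 - s) * ((a₁ - b₁) ^ 2 + (a₂ - b₂) ^ 2) ≤ 1 / 4 * 36 :=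
    mul_le_mul hvs hab (by positivity) (by norm_num)
  have hvr' : r * (1 - r) * ((c₁ - d₁) ^ 2 + (c₂ - d₂) ^ 2) ≤ 1 / 4 * 36 :=
    mul_le_mul hvr hcd (by positivity) (by norm_num)
  obtain ⟨ε, hε, hac', had', hbc', hbd'⟩ : ∃ ε > 0, 36 + ε ≤ (a₁ - c₁) ^ 2 + (a₂ - c₂) ^ 2 ∧
      36 + ε ≤ (a₁ - d₁) ^ 2 + (a₂ - d₂) ^ 2 ∧ 36 + ε ≤ (b₁ - c₁) ^ 2 + (b₂ - c₂) ^ 2 ∧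
      36 + ε ≤ (b₁ - d₁) ^ 2 + (b₂ - d₂) ^ 2 := by
    refine ⟨min (min ((a₁ - c₁) ^ 2 + (a₂ - c₂) ^ 2 - 36) ((a₁ - d₁) ^ 2 + (a₂ - d₂) ^ 2 - 36))
      (min ((b₁ - c₁) ^ 2 + (b₂ - c₂) ^ 2 - 36) ((b₁ - d₁) ^ 2 + (b₂ - d₂) ^ 2 - 36)), ?_, ?_⟩
    · simp only [gt_iff_lt, lt_min_iff]
      refine ⟨⟨?_, ?_⟩, ?_, ?_⟩ <;> linarith
    · refine ⟨?_, ?_, ?_, ?_⟩ <;> grind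
  have h1 := mul_le_mul_of_nonneg_left hac' (mul_nonneg hs1 hr1)
  have h2 := mul_le_mul_of_nonneg_left had' (mul_nonneg hs1 hr)
  have h3 := mul_le_mul_of_nonneg_left hbc' (mul_nonneg hs hr1)
  have h4 := mul_le_mul_of_nonneg_left hbd' (mul_nonneg hs hr)
  linarith

variable {V : Type} {G : SimpleGraph V} {x y : V → ℝ}

/-- The grid point `p` is close to a point of an edge at `v`, where the vertices are drawn
in the plane with coordinates `x`, `y`. -/
def NearStar (G : SimpleGraph V) (x y : V → ℝ) (p : ℤ × ℤ) (v : V) : Prop :=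
  ∃ w, (w = v ∨ G.Adj v w) ∧ ∃ i : ℕ, i ≤ 12 ∧
    p ∈ cellBox 1 (x v + i / 12 * (x w - x v)) (y v + i / 12 * (y w - y v))

theorem near_of_eq_or_adj
    (hG : ∀ u v, G.Adj u v ↔ u ≠ v ∧ (x u - x v) ^ 2 + (y u - y v) ^ 2 ≤ 36) {v w : V}
    (h : w = v ∨ G.Adj v w) : (x v - x w) ^ 2 + (y v - y w) ^ 2 ≤ 36 := by
  rcases h with rfl | h
  · norm_num
  · exact ((hG _ _).1 h).2

theorem eq_or_adj_of_near
    (hG : ∀ u v, G.Adj u v ↔ u ≠ v ∧ (x u - x v) ^ 2 + (y u - y v) ^ 2 ≤ 36) {v w : V}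
    (h : (x v - x w) ^ 2 + (y v - y w) ^ 2 ≤ 36) : v = w ∨ G.Adj v w := by
  by_cases hvw : v = w
  · exact Or.inl hvw
  · exact Or.inr ((hG _ _).2 ⟨hvw, h⟩)

theorem abs_le_six {a b : ℝ} (h : a ^ 2 + b ^ 2 ≤ 36) : |a| ≤ 6 ∧ |b| ≤ 6 :=
  ⟨abs_le_of_sq_le_sq (by nlinarith [sq_nonneg b]) (by norm_num),
    abs_le_of_sq_le_sq (by nlinarith [sq_nonneg a]) (by norm_num)⟩

theorem NearStar.mem_cellBox
    (hG : ∀ u v, G.Adj u v ↔ u ≠ v ∧ (x u - x v) ^ 2 + (y u - y v) ^ 2 ≤ 36) {p : ℤ × ℤ} {v : V}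
    (h : NearStar G x y p v) : p ∈ cellBox 7 (x v) (y v) := by
  obtain ⟨w, hw, i, hi, h1, h2⟩ := h
  obtain ⟨h3, h4⟩ := abs_le_six (near_of_eq_or_adj hG hw)
  have hi0 : (0 : ℝ) ≤ i / 12 := by positivity
  have hi1 : (i : ℝ) / 12 ≤ 1 := by
    rw [div_le_one (by norm_num)]
    exact_mod_cast hi
  have key : ∀ {q a b : ℝ}, |a - b| ≤ 6 → |q - (a + i / 12 * (b - a))| ≤ 1 → |q - a| ≤ 7 := by
    intro q a b h h'
    have : |(i : ℝ) / 12 * (b - a)| ≤ 6 := by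
      rw [abs_mul, abs_of_nonneg hi0, abs_sub_comm]
      calc _ ≤ 1 * |a - b| := by gcongr
        _ ≤ 6 := by linarith
    rw [abs_le] at *
    constructor <;> linarith
  exact ⟨key h3 h1, key h4 h2⟩

theorem NearStar.exists_symm {p : ℤ × ℤ} {v : V} (h : NearStar G x y p v) :
    ∃ w, (w = v ∨ G.Adj v w) ∧ NearStar G x y p w ∧ ∃ s : ℝ, 0 ≤ s ∧ s ≤ 1 ∧
      p ∈ cellBox 1 (x v + s * (x w - x v)) (y v + s * (y w - y v)) := by
  obtain ⟨w, hw, i, hi, hp⟩ := h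
  refine ⟨w, hw, ⟨v, hw.imp Eq.symm fun h => h.symm, 12 - i, by omega, ?_⟩, i / 12,
    by positivity, ?_, hp⟩
  · have : ∀ a b : ℝ, a + ((12 - i : ℕ) : ℝ) / 12 * (b - a) = b + i / 12 * (a - b) := by
      intro a b
      rw [Nat.cast_sub hi]
      push_cast
      ring
    rwa [this, this]
  · rw [div_le_one (by norm_num)]
    exact_mod_cast hi

/-- Stars close to equal or adjacent grid points touch. -/
theorem NearStar.exists_touching
    (hG : ∀ u v, G.Adj u v ↔ u ≠ v ∧ (x u - x v) ^ 2 + (y u - y v) ^ 2 ≤ 36) {p q : ℤ × ℤ}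
    (hpq : p = q ∨ gridGraph.Adj p q) {u v : V} (hu : NearStar G x y p u)
    (hv : NearStar G x y q v) :
    ∃ a b, (a = u ∨ G.Adj u a) ∧ NearStar G x y p a ∧ (b = v ∨ G.Adj v b) ∧ NearStar G x y q b ∧
      (a = b ∨ G.Adj a b) := by
  obtain ⟨u', huu', hu', s, hs, hs', hp1, hp2⟩ := hu.exists_symm
  obtain ⟨v', hvv', hv', r, hr, hr', hq1, hq2⟩ := hv.exists_symm
  have hclose : ∀ {m n : ℤ} {a b : ℝ}, |(m : ℝ) - a| ≤ 1 → |(n : ℝ) - b| ≤ 1 →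
      (m = n → (a - b) ^ 2 ≤ 4) ∧ (m = n ∨ n = m + 1 ∨ m = n + 1 → (a - b) ^ 2 ≤ 9) := by
    intro m n a b ha hb
    rw [abs_le] at ha hb
    constructor
    · rintro rfl
      nlinarith
    · intro hmn
      have h1 : m ≤ n + 1 := by omega
      have h2 : n ≤ m + 1 := by omega
      have h1' : (m : ℝ) ≤ n + 1 := by exact_mod_cast h1
      have h2' : (n : ℝ) ≤ m + 1 := by exact_mod_cast h2
      nlinarith
  have hz := hclose hp1 hq1
  have hz' := hclose hp2 hq2
  have h18 : ((x u + s * (x u' - x u)) - (x v + r * (x v' - x v))) ^ 2 +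
      ((y u + s * (y u' - y u)) - (y v + r * (y v' - y v))) ^ 2 ≤ 18 := by
    rcases hpq with rfl | ⟨h1, h2⟩ | ⟨h1, h2⟩
    · linarith [hz.1 rfl, hz'.1 rfl]
    · linarith [hz.1 h1, hz'.2 (Or.inr h2)]
    · linarith [hz'.1 h1, hz.2 (Or.inr h2)]
  rcases exists_endpoints_near hs hs' hr hr' (near_of_eq_or_adj hG huu')
    (near_of_eq_or_adj hG hvv') h18 with h | h | h | h
  · exact ⟨u, v, Or.inl rfl, hu, Or.inl rfl, hv, eq_or_adj_of_near hG h⟩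
  · exact ⟨u, v', Or.inl rfl, hu, hvv', hv', eq_or_adj_of_near hG h⟩
  · exact ⟨u', v, huu', hu', Or.inl rfl, hv, eq_or_adj_of_near hG h⟩
  · exact ⟨u', v', huu', hu', hvv', hv', eq_or_adj_of_near hG h⟩

theorem setConn_setOf_nearStar_right
    (hG : ∀ u v, G.Adj u v ↔ u ≠ v ∧ (x u - x v) ^ 2 + (y u - y v) ^ 2 ≤ 36) {p : ℤ × ℤ}
    (hp : ∃ v, NearStar G x y p v) : SetConn G {v | NearStar G x y p v} := by
  obtain ⟨u, hu⟩ := hp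
  refine .of_base hu fun v hv => ?_
  obtain ⟨a, b, hua, ha, hvb, hb, hab⟩ := NearStar.exists_touching hG (Or.inl rfl) hu hv
  have step : ∀ {c d : V}, NearStar G x y p d → (c = d ∨ G.Adj c d) →
      Relation.ReflTransGen (fun c d => G.Adj c d ∧ d ∈ {v | NearStar G x y p v}) c d := by
    rintro c d hd (rfl | h)
    · exact .refl
    · exact .single ⟨h, hd⟩
  exact (step ha (hua.imp_left Eq.symm)).trans ((step hb hab).trans
    (step hv (hvb.imp_right fun h => h.symm)))

theorem setConn_setOf_nearStar_left
    (hG : ∀ u v, G.Adj u v ↔ u ≠ v ∧ (x u - x v) ^ 2 + (y u - y v) ^ 2 ≤ 36) (v : V) :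
    SetConn gridGraph {p | NearStar G x y p v} := by
  have h0 : (round (x v), round (y v)) ∈ {p | NearStar G x y p v} :=
    ⟨v, Or.inl rfl, 0, by norm_num, round_mem_cellBox (by simp) (by simp)⟩
  refine .of_base h0 ?_
  rintro p ⟨w, hw, j, hj, hp⟩
  set B : ℕ → Set (ℤ × ℤ) := fun i =>
    cellBox 1 (x v + i / 12 * (x w - x v)) (y v + i / 12 * (y w - y v)) with hB
  obtain ⟨h3, h4⟩ := abs_le_six (near_of_eq_or_adj hG hw)
  have key : ∀ n, ∃ L : Set (ℤ × ℤ), SetConn gridGraph L ∧ B 0 ⊆ L ∧ B n ⊆ L ∧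
      L ⊆ {p | ∃ i ≤ n, p ∈ B i} := by
    intro n
    induction n with
    | zero => exact ⟨B 0, setConn_cellBox _ _, subset_rfl, subset_rfl, fun q hq => ⟨0, le_rfl, hq⟩⟩
    | succ n ih =>
      obtain ⟨L, hL, hL0, hLn, hLs⟩ := ih
      refine ⟨L ∪ B (n + 1), hL.union (setConn_cellBox _ _) (hLn ?_)
        (round_mem_cellBox (a := x v + n / 12 * (x w - x v)) (b := y v + n / 12 * (y w - y v))
          ?_ ?_) (Or.inl rfl), hL0.trans subset_union_left, subset_union_right, ?_⟩
      · exact round_mem_cellBox (by simp) (by simp)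
      · rw [abs_le] at h3 ⊢
        push_cast
        constructor <;> linarith
      · rw [abs_le] at h4 ⊢
        push_cast
        constructor <;> linarith
      · rintro q (hq | hq)
        · obtain ⟨i, hi, hqi⟩ := hLs hq
          exact ⟨i, by omega, hqi⟩
        · exact ⟨n + 1, le_rfl, hq⟩
  obtain ⟨L, hL, hL0, hLj, hLs⟩ := key j
  refine reflTransGen_mono (K := L) ?_ (hL.2 _ (hL0 ?_) _ (hLj hp))
  · intro q hq
    obtain ⟨i, hi, hqi⟩ := hLs hq
    exact ⟨w, hw, i, by omega, hqi⟩
  · exact round_mem_cellBox (by simp) (by simp)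

theorem ncard_nearStar_right_le [Finite V]
    (hG : ∀ u v, G.Adj u v ↔ u ≠ v ∧ (x u - x v) ^ 2 + (y u - y v) ^ 2 ≤ 36) {t : ℕ}
    (ht : G.CliqueFree t) (p : ℤ × ℤ) : {v | NearStar G x y p v}.ncard ≤ 16 * t := by
  classical
  let g : V → ℤ × ℤ := fun v => (⌊(x v - p.1 + 7) / 4⌋, ⌊(y v - p.2 + 7) / 4⌋)
  let I : Finset (ℤ × ℤ) := Finset.Icc 0 3 ×ˢ Finset.Icc 0 3
  have hfib : ∀ a ∈ (I : Set (ℤ × ℤ)), {v | g v = a}.Finite ∧ {v | g v = a}.ncard ≤ t := by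
    intro a _
    refine ⟨toFinite _, ?_⟩
    by_contra! hcon
    obtain ⟨s, hs, hst⟩ := Finset.exists_subset_card_eq
      (s := (toFinite {v | g v = a}).toFinset) (n := t)
      (by rw [← ncard_eq_toFinset_card]; exact hcon.le)
    refine ht s ⟨fun u hu v hv huv => (hG u v).2 ⟨huv, ?_⟩, hst⟩
    have hu' : g u = a := by simpa using hs hu
    have hv' : g v = a := by simpa using hs hv
    have huv' : g u = g v := hu'.trans hv'.symm
    have key : ∀ {b c : ℝ}, ⌊(b + 7) / 4⌋ = ⌊(c + 7) / 4⌋ → (b - c) ^ 2 ≤ 16 := by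
      intro b c h
      have := Int.abs_sub_lt_one_of_floor_eq_floor h
      rw [abs_lt] at this
      nlinarith
    have h1 := key (congrArg Prod.fst huv')
    have h2 := key (congrArg Prod.snd huv')
    rw [sub_sub_sub_cancel_right] at h1 h2
    linarith
  obtain ⟨hfin, hle⟩ := ncard_biUnion_le_mul I.finite_toSet hfib
  rw [ncard_coe_finset, Finset.card_product] at hle
  refine (ncard_le_ncard ?_ hfin).trans (hle.trans_eq (by simp))
  intro v hv
  have hv' := NearStar.mem_cellBox hG hv
  simp only [cellBox, mem_ofPred_eq, abs_le] at hv'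
  obtain ⟨⟨h1, h2⟩, h3, h4⟩ := hv'
  have key : ∀ {a : ℝ}, 0 ≤ a → a ≤ 14 → 0 ≤ ⌊a / 4⌋ ∧ ⌊a / 4⌋ ≤ 3 := by
    intro a h0 h14
    refine ⟨Int.floor_nonneg.2 (by positivity), Int.lt_add_one_iff.1 (Int.floor_lt.2 ?_)⟩
    push_cast
    linarith
  refine mem_biUnion (x := g v) ?_ rfl
  simp only [I, g, Finset.coe_product, Finset.coe_Icc, mem_prod, mem_Icc]
  exact ⟨key (by linarith) (by linarith), key (by linarith) (by linarith)⟩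

theorem exists_common_nearStar {u v : V} (h : G.Adj u v) :
    ∃ p, NearStar G x y p u ∧ NearStar G x y p v :=
  ⟨(round (x u), round (y u)),
    ⟨u, Or.inl rfl, 0, by norm_num, round_mem_cellBox (by simp) (by simp)⟩,
    ⟨u, Or.inr h.symm, 12, le_rfl, round_mem_cellBox (by norm_num) (by norm_num)⟩⟩

/-- The treewidth bound for graphs drawn in the plane such that vertices are adjacent exactly when
they are at distance at most `6`. -/
theorem forestWidthLE_of_drawing [Finite V]
    (hG : ∀ u v, G.Adj u v ↔ u ≠ v ∧ (x u - x v) ^ 2 + (y u - y v) ^ 2 ≤ 36) {t : ℕ}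
    (ht : G.CliqueFree t) {η : ℕ} {X : Set V} (h : ForestWidthLE (G.induce Xᶜ) η) {l : ℕ}
    (hl : ((225 * (η + 1) : ℕ) : ℝ) + gridConst (225 * (η + 1)) * √((X.ncard * 225 : ℕ) : ℝ) ≤ l) :
    ForestWidthLE G ((l + 1) * (16 * t)) := by
  set P : Set (ℤ × ℤ) := {p | ∃ v, NearStar G x y p v} with hP
  have hφ : ∀ v, {p | NearStar G x y p v}.Finite ∧ {p | NearStar G x y p v}.ncard ≤ 225 := by
    intro v
    obtain ⟨h1, h2⟩ := cellBox_finite_and_ncard_le (x v) (y v)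
    have hsub : {p | NearStar G x y p v} ⊆ cellBox 7 (x v) (y v) :=
      fun p hp => NearStar.mem_cellBox hG hp
    exact ⟨h1.subset hsub, (ncard_le_ncard hsub h1).trans h2⟩
  have hPfin : P.Finite := by
    have : P = ⋃ v, {p | NearStar G x y p v} := by ext; simp [hP]
    rw [this]
    exact finite_iUnion fun v => (hφ v).1
  have : Finite P := hPfin
  have hφP : ∀ v, (Subtype.val ⁻¹' {p | NearStar G x y p v} : Set P).ncard ≤ 225 := by
    intro v
    rw [← ncard_image_of_injective _ Subtype.val_injective, Subtype.image_preimage_coe]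
    exact (ncard_le_ncard inter_subset_right (hφ v).1).trans (hφ v).2
  set Y : Set P := ⋃ v ∈ X, Subtype.val ⁻¹' {p | NearStar G x y p v} with hY
  have hYcard : Y.ncard ≤ X.ncard * 225 :=
    (ncard_biUnion_le_mul (toFinite X) fun v _ => ⟨toFinite _, hφP v⟩).2
  have hPY : ForestWidthLE ((gridGraph.induce P).induce Yᶜ) (225 * (η + 1)) := by
    refine h.transfer (c := 225) (fun v p => NearStar G x y p.1.1 v.1) ?_ ?_ ?_ (by omega)
    · intro p
      refine (setConn_setOf_nearStar_right hG p.1.2).preimage_val fun v hv hvX => p.2 ?_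
      exact mem_biUnion hvX hv
    · intro p q hpq
      obtain ⟨u, hu⟩ := p.1.2
      obtain ⟨v, hv⟩ := q.1.2
      obtain ⟨a, b, -, ha, -, hb, hab⟩ := NearStar.exists_touching hG (Or.inr hpq) hu hv
      refine ⟨⟨a, fun haX => p.2 (mem_biUnion haX ha)⟩, ⟨b, fun hbX => q.2 (mem_biUnion hbX hb)⟩,
        ha, hb, hab.imp_left fun h => Subtype.ext h⟩
    · intro v
      refine ⟨toFinite _, le_trans ?_ (hφP v.1)⟩
      rw [← ncard_image_of_injective _ Subtype.val_injective]
      refine ncard_le_ncard ?_ (toFinite _)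
      rintro _ ⟨p, hp, rfl⟩
      exact hp
  have hgrid : ForestWidthLE (gridGraph.induce P) l := by
    refine forestWidthLE_grid Subtype.val_injective (fun _ _ h => h) hPY (le_trans ?_ hl)
    gcongr
    exact gridConst_nonneg _
  refine hgrid.transfer (c := 16 * t) (fun p v => NearStar G x y p.1 v) ?_ ?_ ?_ (by omega)
  · exact fun v => (setConn_setOf_nearStar_left hG v).preimage_val fun p hp => ⟨v, hp⟩
  · intro u v huv
    obtain ⟨p, hu, hv⟩ := exists_common_nearStar (x := x) (y := y) huv
    exact ⟨⟨p, u, hu⟩, ⟨p, u, hu⟩, hu, hv, Or.inl rfl⟩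
  · exact fun p => ⟨toFinite _, ncard_nearStar_right_le hG ht p.1⟩

end Geometry

end SublinearTreewidth

/-- For every `t`, the class of unit disk graphs containing no
complete graph on `t` vertices as a subgraph has truly sublinear treewidth with
parameter `λ = 1/2`. -/
theorem ktFree_unitDiskGraphs_truly_sublinear_treewidth (t : ℕ) :
    HasTrulySublinearTreewidth
      (fun _V G => IsUnitDiskGraph G ∧ G.CliqueFree t) ((1 : ℝ) / 2) := by
  intro η hη
  have hC := SublinearTreewidth.gridConst_nonneg (225 * (η + 1))
  set C := SublinearTreewidth.gridConst (225 * (η + 1)) with hCdef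
  refine ⟨16 * t * (225 * (η + 1) + 15 * C + 2) + 1, by positivity, ?_⟩
  rintro V _ G ⟨⟨c, hc⟩, ht⟩ X hX
  rw [SublinearTreewidth.treewidth_le_iff] at hX
  rw [← Real.sqrt_eq_rpow]
  rcases X.eq_empty_or_nonempty with rfl | hne
  · have : G.treewidth ≤ η := by
      refine SublinearTreewidth.treewidth_le_iff.2 (hX.comap (fun v => ⟨v, by simp⟩)
        (fun u v huv => ?_) fun _ _ => id)
      exact congrArg Subtype.val huv
    simpa using this
  have hG : ∀ u v, G.Adj u v ↔ u ≠ v ∧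
      (3 * c u 0 - 3 * c v 0) ^ 2 + (3 * c u 1 - 3 * c v 1) ^ 2 ≤ 36 := by
    intro u v
    rw [hc u v, EuclideanSpace.dist_eq, Real.sqrt_le_left (by norm_num), Fin.sum_univ_two,
      Real.dist_eq, Real.dist_eq, sq_abs, sq_abs]
    refine and_congr_right fun _ => ⟨fun h => ?_, fun h => ?_⟩ <;> linarith
  set L : ℕ := ⌈((225 * (η + 1) : ℕ) : ℝ) + C * √((X.ncard * 225 : ℕ) : ℝ)⌉₊ with hL
  have htw : G.treewidth ≤ (L + 1) * (16 * t) := SublinearTreewidth.treewidth_le_iff.2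
    (SublinearTreewidth.forestWidthLE_of_drawing hG ht hX (Nat.le_ceil _))
  have hn1 : (1 : ℝ) ≤ √(X.ncard : ℝ) := by
    rw [Real.one_le_sqrt]
    exact_mod_cast (ncard_pos (toFinite X)).2 hne
  have hL1 : (L : ℝ) ≤ 225 * (η + 1) + C * (√(X.ncard : ℝ) * 15) + 1 := by
    have h := (Nat.ceil_lt_add_one (a := ((225 * (η + 1) : ℕ) : ℝ) +
      C * √((X.ncard * 225 : ℕ) : ℝ)) (by positivity)).le
    have h15 : √((X.ncard * 225 : ℕ) : ℝ) = √(X.ncard : ℝ) * 15 := by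
      push_cast
      rw [Real.sqrt_mul (by positivity), show (225 : ℝ) = 15 ^ 2 by norm_num,
        Real.sqrt_sq (by norm_num)]
    rw [h15] at h
    rw [hL, h15]
    push_cast at h ⊢
    exact h
  have hL2 : (L : ℝ) + 1 ≤ (225 * (η + 1) + 15 * C + 2) * √(X.ncard : ℝ) := by
    have : 0 ≤ (225 * ((η : ℝ) + 1) + 2) * (√(X.ncard : ℝ) - 1) :=
      mul_nonneg (by positivity) (by linarith)
    linarith
  calc (G.treewidth : ℝ) ≤ ((L : ℝ) + 1) * (16 * t) := by exact_mod_cast htw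
    _ ≤ (225 * (η + 1) + 15 * C + 2) * √(X.ncard : ℝ) * (16 * t) := by gcongr
    _ ≤ η + (16 * t * (225 * (η + 1) + 15 * C + 2) + 1) * √(X.ncard : ℝ) := by
      have : (0 : ℝ) ≤ η := by positivity
      linarith
end

section
/- Let G be a unit disk graph and let X ⊆ V(G) be a clique in G. Then there exists a maximum-size cycle packing C_1, C_2, …, C_p in G such that at most 1485 of the cycles C_i satisfy both C_i ∩ X ≠ ∅ and C_i ∖ X ≠ ∅; moreover, at most 54 cycles in the packing intersect X in exactly two vertices and at most 1458 cycles intersect X in exactly one vertex. -/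
open SimpleGraph Set Metric

/-- `C` induces a cycle in `G`: the induced subgraph `G[C]` is connected and
`2`-regular. -/
def InducesCycle {V : Type} [Fintype V] (G : SimpleGraph V) (C : Set V) : Prop :=
  (G.induce C).Connected ∧ ∀ x : C, ((G.induce C).neighborSet x).ncard = 2

/-- A cycle packing in `G`: a collection of pairwise disjoint vertex sets, each
inducing a cycle in `G`.  Its size is the number of sets in the collection. -/
def IsCyclePacking {V : Type} [Fintype V] (G : SimpleGraph V) (P : Finset (Set V)) : Prop :=
  (∀ C ∈ P, InducesCycle G C) ∧ (P : Set (Set V)).Pairwise Disjoint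

/-- If a set of reals of diameter at most `2` is enlarged by `2`, the result is split by five
classes of diameter at most `7 / 5`. -/
lemma exists_five_intervals {V : Type} [Finite V] (X : Set V) (f : V → ℝ)
    (hf : ∀ x ∈ X, ∀ y ∈ X, |f x - f y| ≤ 2) :
    ∃ k : V → Fin 5, ∀ u v, (∃ x ∈ X, |f x - f u| ≤ 2) → (∃ x ∈ X, |f x - f v| ≤ 2) →
      k u = k v → |f u - f v| ≤ 7 / 5 := by
  rcases X.eq_empty_or_nonempty with rfl | hne
  · exact ⟨fun _ => 0, by simp⟩
  obtain ⟨z, hz, hmin⟩ := Set.exists_min_image X f X.toFinite hne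
  have key : ∀ u, (∃ x ∈ X, |f x - f u| ≤ 2) →
      0 ≤ (f u - (f z - 2)) / (7 / 5) ∧ (f u - (f z - 2)) / (7 / 5) < 5 := by
    rintro u ⟨x, hx, hxu⟩
    have h1 := hmin x hx
    have h2 := abs_le.1 (hf x hx z hz)
    have h3 := abs_le.1 hxu
    constructor
    · apply div_nonneg <;> linarith
    · rw [div_lt_iff₀ (by norm_num)]
      linarith
  refine ⟨fun u => Fin.ofNat 5 ⌊(f u - (f z - 2)) / (7 / 5)⌋₊, fun u v hu hv huv => ?_⟩
  obtain ⟨hu0, hu5⟩ := key u hu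
  obtain ⟨hv0, hv5⟩ := key v hv
  have hu' : ⌊(f u - (f z - 2)) / (7 / 5)⌋₊ < 5 := (Nat.floor_lt hu0).2 (by exact_mod_cast hu5)
  have hv' : ⌊(f v - (f z - 2)) / (7 / 5)⌋₊ < 5 := (Nat.floor_lt hv0).2 (by exact_mod_cast hv5)
  have heq : ⌊(f u - (f z - 2)) / (7 / 5)⌋₊ = ⌊(f v - (f z - 2)) / (7 / 5)⌋₊ := by
    have := congrArg Fin.val huv
    simpa only [Fin.val_ofNat, Nat.mod_eq_of_lt hu', Nat.mod_eq_of_lt hv'] using this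
  have a1 := Nat.floor_le hu0
  have a2 := Nat.lt_floor_add_one ((f u - (f z - 2)) / (7 / 5))
  have b1 := Nat.floor_le hv0
  have b2 := Nat.lt_floor_add_one ((f v - (f z - 2)) / (7 / 5))
  rw [heq] at a1 a2
  rw [abs_le]
  constructor <;> linarith

/-- The closed neighbourhood of a clique `X` of a unit disk graph is partitioned into `X` and
`25` further cliques. -/
lemma exists_clique_labelling {V : Type} [Finite V] {G : SimpleGraph V}
    (hG : IsUnitDiskGraph G) {X : Set V} (hX : G.IsClique X) :
    ∃ L : V → Option (Fin 5 × Fin 5), (∀ v, L v = none ↔ v ∈ X) ∧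
      ∀ u v, (u ∈ X ∨ ∃ x ∈ X, G.Adj x u) → (v ∈ X ∨ ∃ x ∈ X, G.Adj x v) →
        u ≠ v → L u = L v → G.Adj u v := by
  classical
  obtain ⟨c, hc⟩ := hG
  have coord : ∀ (u v : V) (i : Fin 2), dist (c u) (c v) ≤ 2 → |c u i - c v i| ≤ 2 := by
    intro u v i h
    rw [EuclideanSpace.dist_eq] at h
    refine le_trans ?_ h
    rw [← Real.dist_eq, ← Real.sqrt_sq (dist_nonneg (x := c u i))]
    exact Real.sqrt_le_sqrt
      (Finset.single_le_sum (f := fun i => dist (c u i) (c v i) ^ 2)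
        (fun _ _ => sq_nonneg _) (Finset.mem_univ i))
  have hXd : ∀ i : Fin 2, ∀ x ∈ X, ∀ y ∈ X, |c x i - c y i| ≤ 2 := by
    intro i x hx y hy
    rcases eq_or_ne x y with rfl | hxy
    · simp
    · exact coord x y i ((hc x y).1 (hX hx hy hxy)).2
  have near : ∀ u, (u ∈ X ∨ ∃ x ∈ X, G.Adj x u) → ∀ i : Fin 2, ∃ x ∈ X, |c x i - c u i| ≤ 2 := by
    rintro u (hu | ⟨x, hx, hxu⟩) i
    · exact ⟨u, hu, by simp⟩
    · exact ⟨x, hx, coord x u i ((hc x u).1 hxu).2⟩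
  choose k hk using fun i : Fin 2 => exists_five_intervals X (fun v => c v i) (hXd i)
  refine ⟨fun v => if v ∈ X then none else some (k 0 v, k 1 v), fun v => by simp, ?_⟩
  intro u v hu hv huv hL
  by_cases huX : u ∈ X <;> by_cases hvX : v ∈ X <;> simp [huX, hvX] at hL
  · exact hX huX hvX huv
  · refine (hc u v).2 ⟨huv, ?_⟩
    have h0 := abs_le.1 (hk 0 u v (near u hu 0) (near v hv 0) hL.1)
    have h1 := abs_le.1 (hk 1 u v (near u hu 1) (near v hv 1) hL.2)
    rw [EuclideanSpace.dist_eq, Real.sqrt_le_left (by norm_num), Fin.sum_univ_two,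
      Real.dist_eq, Real.dist_eq, sq_abs, sq_abs]
    nlinarith [h0.1, h0.2, h1.1, h1.2]

section Cycles

variable {V : Type} [Fintype V] {G : SimpleGraph V} {C X : Set V}

lemma inducesCycle_triangle {a b c : V} (hab : G.Adj a b) (hac : G.Adj a c) (hbc : G.Adj b c) :
    InducesCycle G {a, b, c} := by
  have hadj : ∀ u v : ({a, b, c} : Set V), (G.induce {a, b, c}).Adj u v ↔ u ≠ v := by
    rintro ⟨u, hu⟩ ⟨v, hv⟩
    simp only [Set.mem_insert_iff, Set.mem_singleton_iff] at hu hv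
    rcases hu with rfl | rfl | rfl <;> rcases hv with rfl | rfl | rfl <;>
      simp [hab, hac, hbc, hab.symm, hac.symm, hbc.symm, hab.ne, hac.ne, hbc.ne,
        hab.ne.symm, hac.ne.symm, hbc.ne.symm]
  refine ⟨⟨fun u v => ?_⟩, fun x => ?_⟩
  · rcases eq_or_ne u v with rfl | h
    · exact .refl _
    · exact ((hadj u v).2 h).reachable
  · have hn : (G.induce {a, b, c}).neighborSet x = {x}ᶜ := by
      ext y
      rw [SimpleGraph.mem_neighborSet, hadj]
      simp [eq_comm]
    have hcard : Nat.card ({a, b, c} : Set V) = 3 := by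
      rw [Nat.card_coe_set_eq]
      exact Set.ncard_eq_three.2 ⟨a, b, c, hab.ne, hac.ne, hbc.ne, rfl⟩
    rw [hn, Set.ncard_compl, hcard, Set.ncard_singleton]

lemma InducesCycle.nonempty (h : InducesCycle G C) : C.Nonempty :=
  Set.nonempty_coe_sort.1 h.1.nonempty

lemma InducesCycle.exists_two_neighbors (h : InducesCycle G C) {p : V} (hp : p ∈ C) :
    ∃ q ∈ C, ∃ r ∈ C, q ≠ r ∧ G.Adj p q ∧ G.Adj p r := by
  obtain ⟨⟨q, hq⟩, ⟨r, hr⟩, hqr, hs⟩ := Set.ncard_eq_two.1 (h.2 ⟨p, hp⟩)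
  have h1 : (⟨q, hq⟩ : C) ∈ (G.induce C).neighborSet ⟨p, hp⟩ := by simp [hs]
  have h2 : (⟨r, hr⟩ : C) ∈ (G.induce C).neighborSet ⟨p, hp⟩ := by simp [hs]
  exact ⟨q, hq, r, hr, by simpa using hqr, by simpa using h1, by simpa using h2⟩

lemma InducesCycle.diff_nonempty (h : InducesCycle G C) (hn : (C ∩ X).ncard ≤ 2) :
    (C \ X).Nonempty := by
  by_contra hne
  have hCX : C ⊆ X := Set.sdiff_eq_empty.1 (Set.not_nonempty_iff_eq_empty.1 hne)
  obtain ⟨p, hp⟩ := h.nonempty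
  obtain ⟨q, hq, r, hr, hqr, hpq, hpr⟩ := h.exists_two_neighbors hp
  have h3 : ({p, q, r} : Set V).ncard = 3 :=
    Set.ncard_eq_three.2 ⟨p, q, r, hpq.ne, hpr.ne, hqr, rfl⟩
  have hsub : ({p, q, r} : Set V) ⊆ C ∩ X := by
    rw [Set.inter_eq_left.2 hCX]
    rintro x (rfl | rfl | rfl) <;> assumption
  have := Set.ncard_le_ncard hsub (Set.toFinite _)
  omega

omit [Fintype V] in
/-- A connected induced subgraph meeting `X` and its complement has an edge leaving `X`. -/
lemma exists_adj_of_connected_induce (h : (G.induce C).Connected) (h1 : (C ∩ X).Nonempty)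
    (h2 : (C \ X).Nonempty) : ∃ p ∈ C ∩ X, ∃ r ∈ C \ X, G.Adj p r := by
  obtain ⟨a, haC, haX⟩ := h1
  obtain ⟨b, hbC, hbX⟩ := h2
  obtain ⟨w⟩ := h.preconnected ⟨a, haC⟩ ⟨b, hbC⟩
  obtain ⟨d, -, hd1, hd2⟩ := w.exists_boundary_dart {v | (v : V) ∈ X} haX hbX
  exact ⟨d.fst, ⟨d.fst.2, hd1⟩, d.snd, ⟨d.snd.2, hd2⟩, by simpa using d.adj⟩

/-- A cycle crossing `X` contains three distinct vertices of the closed neighbourhood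
of `X`, one in `X` and one outside; the third is in `X` if the cycle meets `X` exactly twice, and
outside if the cycle meets `X` exactly once. -/
lemma InducesCycle.exists_crossing_triple (h : InducesCycle G C)
    (h1 : (C ∩ X).Nonempty) (h2 : (C \ X).Nonempty) :
    ∃ v : Fin 3 → V, Function.Injective v ∧ (∀ j, v j ∈ C) ∧
      (∀ j, v j ∈ X ∨ ∃ x ∈ X, G.Adj x (v j)) ∧ v 0 ∈ X ∧ v 2 ∉ X ∧
      ((C ∩ X).ncard = 2 → v 1 ∈ X) ∧ ((C ∩ X).ncard = 1 → v 1 ∉ X) := by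
  obtain ⟨p, ⟨hpC, hpX⟩, r, ⟨hrC, hrX⟩, hpr⟩ := exists_adj_of_connected_induce h.1 h1 h2
  have inj : ∀ {a b c : V}, a ≠ b → a ≠ c → b ≠ c → Function.Injective ![a, b, c] := by
    intro a b c hab hac hbc i j hij
    fin_cases i <;> fin_cases j <;> simp_all
  by_cases hq : ∃ q ∈ C ∩ X, q ≠ p
  · obtain ⟨q, ⟨hqC, hqX⟩, hqp⟩ := hq
    have hqr : q ≠ r := fun h => hrX (h ▸ hqX)
    refine ⟨![p, q, r], inj hqp.symm hpr.ne hqr, ?_, ?_, hpX, hrX, fun _ => hqX,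
      fun h1 => absurd ?_ hqp⟩
    · simp [Fin.forall_fin_succ, hpC, hqC, hrC]
    · simp only [Fin.forall_fin_succ]
      exact ⟨.inl hpX, .inl hqX, .inr ⟨p, hpX, hpr⟩, fun i => i.elim0⟩
    · exact Set.ncard_le_one (Set.toFinite _) |>.1 h1.le q ⟨hqC, hqX⟩ p ⟨hpC, hpX⟩
  · push Not at hq
    obtain ⟨a, haC, b, hbC, hab, hpa, hpb⟩ := h.exists_two_neighbors hpC
    refine ⟨![p, a, b], inj hpa.ne hpb.ne hab, ?_, ?_, hpX,
      fun hb => hpb.ne (hq b ⟨hbC, hb⟩).symm, fun h2 => ?_,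
      fun _ ha => hpa.ne (hq a ⟨haC, ha⟩).symm⟩
    · simp [Fin.forall_fin_succ, hpC, haC, hbC]
    · simp only [Fin.forall_fin_succ]
      exact ⟨.inl hpX, .inr ⟨p, hpX, hpa⟩, .inr ⟨p, hpX, hpb⟩, fun i => i.elim0⟩
    · have : C ∩ X = {p} := Set.eq_singleton_iff_unique_mem.2 ⟨⟨hpC, hpX⟩, hq⟩
      simp [this] at h2

open Classical in
/-- Replacing a subfamily `S` of a packing by a packing `T` of the vertices covered by `S`. -/
lemma IsCyclePacking.exchange {P S T : Finset (Set V)} (hP : IsCyclePacking G P) (hS : S ⊆ P)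
    (hT : IsCyclePacking G T) (hTS : ∀ D ∈ T, ∀ x ∈ D, ∃ C ∈ S, x ∈ C) :
    IsCyclePacking G (P \ S ∪ T) ∧ (P \ S ∪ T).card = P.card - S.card + T.card := by
  have hdis : ∀ C ∈ P \ S, ∀ D ∈ T, Disjoint C D := by
    intro C hC D hD
    rw [Finset.mem_sdiff] at hC
    refine Set.disjoint_left.2 fun x hxC hxD => ?_
    obtain ⟨E, hE, hxE⟩ := hTS D hD x hxD
    have hne : C ≠ E := fun h => hC.2 (h ▸ hE)
    exact Set.disjoint_left.1 (hP.2 hC.1 (hS hE) hne) hxC hxE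
  refine ⟨⟨fun C hC => ?_, fun C hC D hD hCD => ?_⟩, ?_⟩
  · rcases Finset.mem_union.1 hC with hC | hC
    · exact hP.1 C (Finset.mem_sdiff.1 hC).1
    · exact hT.1 C hC
  · rcases Finset.mem_union.1 (Finset.mem_coe.1 hC) with hC | hC <;>
      rcases Finset.mem_union.1 (Finset.mem_coe.1 hD) with hD | hD
    · exact hP.2 (Finset.mem_sdiff.1 hC).1 (Finset.mem_sdiff.1 hD).1 hCD
    · exact hdis C hC D hD
    · exact (hdis D hD C hC).symm
    · exact hT.2 hC hD hCD
  · rw [Finset.card_union_of_disjoint, Finset.card_sdiff_of_subset hS]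
    refine Finset.disjoint_left.2 fun C hC hC' => ?_
    obtain ⟨x, hx⟩ := (hT.1 C hC').nonempty
    exact Set.disjoint_left.1 (hdis C hC C hC') hx hx

open Classical in
/-- Three cycles `C 0`, `C 1`, `C 2` of a packing can be replaced by three triangles, each having
one vertex in each of the cycles. -/
lemma IsCyclePacking.exchange_triangles {P : Finset (Set V)} (hP : IsCyclePacking G P)
    {C : Fin 3 → Set V} (hC : Function.Injective C) (hCP : ∀ i, C i ∈ P) {v : Fin 3 → Fin 3 → V}
    (hvC : ∀ i j, v i j ∈ C i) (hv : ∀ i, Function.Injective (v i))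
    (hadj : ∀ j i i', i ≠ i' → G.Adj (v i j) (v i' j)) :
    ∃ Q, IsCyclePacking G Q ∧ Q.card = P.card ∧
      ∀ D ∈ Q, (D ∈ P ∧ ∀ i, D ≠ C i) ∨ ∃ j, D = Set.range fun i => v i j := by
  have hT : ∀ j j', j ≠ j' → Disjoint (Set.range fun i => v i j) (Set.range fun i => v i j') := by
    intro j j' hj
    rw [Set.disjoint_left]
    rintro _ ⟨i, rfl⟩ ⟨i', h⟩
    have h : v i' j' = v i j := h
    by_cases hi : i = i'
    · subst hi
      exact hj (hv i h).symm
    · exact Set.disjoint_left.1 (hP.2 (hCP i) (hCP i') (hC.ne hi)) (hvC i j) (h ▸ hvC i' j')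
  have hTinj : Function.Injective fun j => Set.range fun i => v i j := by
    intro j j' h
    by_contra hj
    exact Set.disjoint_left.1 (hT j j' hj) ⟨0, rfl⟩
      ((Set.ext_iff.1 h (v 0 j)).1 ⟨0, rfl⟩)
  have hTP : IsCyclePacking G (Finset.univ.image fun j => Set.range fun i => v i j) := by
    constructor
    · intro D hD
      obtain ⟨j, -, rfl⟩ := Finset.mem_image.1 hD
      have : (Set.range fun i => v i j) = {v 0 j, v 1 j, v 2 j} := by
        ext x
        simp [Fin.exists_fin_succ, eq_comm]
      rw [this]
      exact inducesCycle_triangle (hadj j 0 1 (by decide)) (hadj j 0 2 (by decide))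
        (hadj j 1 2 (by decide))
    · intro D hD E hE hDE
      obtain ⟨j, -, rfl⟩ := Finset.mem_image.1 hD
      obtain ⟨j', -, rfl⟩ := Finset.mem_image.1 hE
      exact hT j j' fun h => hDE (h ▸ rfl)
  have hS : Finset.univ.image C ⊆ P := by
    intro D hD
    obtain ⟨i, -, rfl⟩ := Finset.mem_image.1 hD
    exact hCP i
  obtain ⟨hQ, hcard⟩ := hP.exchange hS hTP (by
    intro D hD x hx
    obtain ⟨j, -, rfl⟩ := Finset.mem_image.1 hD
    obtain ⟨i, rfl⟩ := hx
    exact ⟨C i, Finset.mem_image_of_mem C (Finset.mem_univ i), hvC i j⟩)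
  refine ⟨_, hQ, ?_, fun D hD => ?_⟩
  · have h3 := Finset.card_le_card hS
    rw [Finset.card_image_of_injective _ hC] at h3 hcard
    rw [Finset.card_image_of_injective _ hTinj] at hcard
    omega
  · rcases Finset.mem_union.1 hD with hD | hD
    · rw [Finset.mem_sdiff] at hD
      exact .inl ⟨hD.1, fun i h =>
        hD.2 (h ▸ Finset.mem_image_of_mem C (Finset.mem_univ i))⟩
    · obtain ⟨j, -, rfl⟩ := Finset.mem_image.1 hD
      exact .inr ⟨j, rfl⟩

/-- Among the maximum cycle packings there is one minimizing `μ`. -/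
lemma exists_max_isCyclePacking_min (G : SimpleGraph V) (μ : Finset (Set V) → ℕ) :
    ∃ P, IsCyclePacking G P ∧ (∀ Q, IsCyclePacking G Q → Q.card ≤ P.card) ∧
      ∀ Q, IsCyclePacking G Q → Q.card = P.card → μ P ≤ μ Q := by
  obtain ⟨M, hM, hmax⟩ := Set.exists_max_image {P | IsCyclePacking G P} Finset.card
    (Set.toFinite _) ⟨∅, by simp [IsCyclePacking]⟩
  obtain ⟨P, ⟨hP, hPM⟩, hmin⟩ := Set.exists_min_image
    {P | IsCyclePacking G P ∧ P.card = M.card} μ (Set.toFinite _) ⟨M, hM, rfl⟩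
  exact ⟨P, hP, fun Q hQ => hPM ▸ hmax Q hQ, fun Q hQ h => hmin Q ⟨hQ, h.trans hPM⟩⟩

end Cycles

/-- Let `G` be a unit disk graph and `X` a clique in `G`.  Then there
is a maximum-size cycle packing of `G` in which at most `1485` cycles cross `X` (meet
both `X` and its complement); moreover at most `54` cycles of the packing intersect `X`
in exactly two vertices and at most `1458` cycles intersect `X` in exactly one
vertex. -/
theorem exists_max_cyclePacking_few_crossing_clique
    {V : Type} [Fintype V] (G : SimpleGraph V) (hG : IsUnitDiskGraph G)
    (X : Set V) (hX : G.IsClique X) :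
    ∃ P : Finset (Set V), IsCyclePacking G P ∧
      (∀ Q : Finset (Set V), IsCyclePacking G Q → Q.card ≤ P.card) ∧
      {C : Set V | C ∈ P ∧ (C ∩ X).Nonempty ∧ (C \ X).Nonempty}.ncard ≤ 1485 ∧
      {C : Set V | C ∈ P ∧ (C ∩ X).ncard = 2}.ncard ≤ 54 ∧
      {C : Set V | C ∈ P ∧ (C ∩ X).ncard = 1}.ncard ≤ 1458 := by
  classical
  obtain ⟨L, hLX, hL⟩ := exists_clique_labelling hG hX
  let crosses : Set V → Prop := fun C => (C ∩ X).Nonempty ∧ (C \ X).Nonempty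
  obtain ⟨P, hP, hmax, hmin⟩ :=
    exists_max_isCyclePacking_min G fun P => (P.filter crosses).card
  have htriple : ∀ C : Set V, ∃ k : Option (Fin 5 × Fin 5) × Option (Fin 5 × Fin 5),
      C ∈ P.filter crosses → ∃ v : Fin 3 → V, Function.Injective v ∧ (∀ j, v j ∈ C) ∧
        (∀ j, v j ∈ X ∨ ∃ x ∈ X, G.Adj x (v j)) ∧ (∀ j, L (v j) = ![none, k.1, k.2] j) ∧
        k.2 ≠ none ∧ ((C ∩ X).ncard = 2 → k.1 = none) ∧ ((C ∩ X).ncard = 1 → k.1 ≠ none) := by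
    intro C
    by_cases hC : C ∈ P.filter crosses
    · obtain ⟨hCP, h1, h2⟩ := Finset.mem_filter.1 hC
      obtain ⟨v, hv, hvC, hvX, h0, h2, htwo, hone⟩ :=
        (hP.1 C hCP).exists_crossing_triple h1 h2
      refine ⟨(L (v 1), L (v 2)), fun _ => ⟨v, hv, hvC, hvX, ?_, fun h => h2 ((hLX _).1 h),
        fun h => (hLX _).2 (htwo h), fun h h' => hone h ((hLX _).1 h')⟩⟩
      simp [Fin.forall_fin_succ, (hLX _).2 h0]
    · exact ⟨default, fun h => absurd h hC⟩
  choose κ hκ using htriple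
  have hfiber : ∀ k, ((P.filter crosses).filter fun C => κ C = k).card ≤ 2 := by
    intro k
    by_contra! hk
    obtain ⟨C⟩ : Nonempty (Fin 3 ↪ {C // C ∈ (P.filter crosses).filter fun C => κ C = k}) :=
      Function.Embedding.nonempty_of_card_le (by simpa only [Fintype.card_fin, Fintype.card_coe])
    have hC : ∀ i, (C i : Set V) ∈ P.filter crosses ∧ κ (C i) = k := fun i =>
      Finset.mem_filter.1 (C i).2
    choose v hv hvC hvX hvL _ _ _ using fun i => hκ (C i) (hC i).1
    have hvL' : ∀ i j, L (v i j) = ![none, k.1, k.2] j := fun i j => by rw [hvL i j, (hC i).2]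
    have hCinj : Function.Injective fun i => (C i : Set V) :=
      Subtype.val_injective.comp C.injective
    have hCP : ∀ i, (C i : Set V) ∈ P := fun i => (Finset.mem_filter.1 (hC i).1).1
    obtain ⟨Q, hQ, hcard, hQD⟩ := hP.exchange_triangles hCinj hCP hvC hv fun j i i' hi =>
      hL _ _ (hvX i j) (hvX i' j)
        (fun h => Set.disjoint_left.1 (hP.2 (hCP i) (hCP i') (hCinj.ne hi)) (hvC i j)
          (h ▸ hvC i' j))
        ((hvL' i j).trans (hvL' i' j).symm)
    refine (hmin Q hQ hcard).not_gt (Finset.card_lt_card ?_)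
    rw [Finset.ssubset_iff_of_subset]
    · exact ⟨C 0, (hC 0).1, fun h => by
        obtain ⟨hmem, ⟨x, hx, hxX⟩, y, hy, hyX⟩ := Finset.mem_filter.1 h
        rcases hQD _ hmem with ⟨-, h⟩ | ⟨j, h⟩
        · exact h 0 rfl
        · rw [h] at hx hy
          obtain ⟨i, rfl⟩ := hx
          obtain ⟨i', rfl⟩ := hy
          exact hyX ((hLX _).1 ((hvL' i' j).trans ((hvL' i j).symm.trans ((hLX _).2 hxX))))⟩
    · intro D hD
      obtain ⟨hmem, hcr⟩ := Finset.mem_filter.1 hD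
      rcases hQD D hmem with ⟨hDP, -⟩ | ⟨j, rfl⟩
      · exact Finset.mem_filter.2 ⟨hDP, hcr⟩
      · obtain ⟨⟨_, ⟨i, rfl⟩, hxX⟩, _, ⟨i', rfl⟩, hyX⟩ := hcr
        exact absurd
          ((hLX _).1 ((hvL' i' j).trans ((hvL' i j).symm.trans ((hLX _).2 hxX)))) hyX
  have hbound : ∀ (A : Set (Set V)) (K : Finset (Option (Fin 5 × Fin 5) × Option (Fin 5 × Fin 5))),
      (∀ C ∈ A, C ∈ P.filter crosses ∧ κ C ∈ K) → A.ncard ≤ 2 * K.card := by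
    intro A K hA
    calc A.ncard ≤ ((P.filter crosses).filter fun C => κ C ∈ K).card := by
          rw [← Set.ncard_coe_finset]
          exact Set.ncard_le_ncard (fun C hC => Finset.mem_coe.2 (Finset.mem_filter.2 (hA C hC)))
            (Set.toFinite _)
      _ ≤ 2 * K.card := by
          refine Finset.card_le_mul_card_image_of_maps_to
            (fun C hC => (Finset.mem_filter.1 hC).2) 2 fun k _ => le_trans ?_ (hfiber k)
          exact Finset.card_le_card
            (Finset.filter_subset_filter _ (Finset.filter_subset _ _))
  have hcross : ∀ C ∈ P, (C ∩ X).ncard = 1 ∨ (C ∩ X).ncard = 2 → C ∈ P.filter crosses := by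
    intro C hC h
    refine Finset.mem_filter.2 ⟨hC, Set.nonempty_of_ncard_ne_zero (by omega),
      (hP.1 C hC).diff_nonempty (by omega)⟩
  refine ⟨P, hP, hmax, ?_, ?_, ?_⟩
  · refine (hbound _ (Finset.univ ×ˢ {none}ᶜ) fun C hC => ?_).trans ?_
    · have hC' : C ∈ P.filter crosses := Finset.mem_filter.2 hC
      obtain ⟨_, _, _, _, _, h, _⟩ := hκ C hC'
      exact ⟨hC', by simpa using h⟩
    · simp [Finset.card_compl]
  · refine (hbound _ ({none} ×ˢ {none}ᶜ) fun C hC => ?_).trans ?_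
    · have hC' := hcross C hC.1 (.inr hC.2)
      obtain ⟨_, _, _, _, _, h, htwo, _⟩ := hκ C hC'
      exact ⟨hC', Finset.mem_product.2 ⟨Finset.mem_singleton.2 (htwo hC.2), by simpa using h⟩⟩
    · simp [Finset.card_compl]
  · refine (hbound _ ({none}ᶜ ×ˢ {none}ᶜ) fun C hC => ?_).trans ?_
    · have hC' := hcross C hC.1 (.inl hC.2)
      obtain ⟨_, _, _, _, _, h, _, hone⟩ := hκ C hC'
      exact ⟨hC', Finset.mem_product.2 ⟨by simpa using hone hC.2, by simpa using h⟩⟩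
    · simp [Finset.card_compl]
end

section
/- Let C be a hereditary graph class of sublinear treewidth with parameter λ ∈ (0,1), i.e., there is a constant β such that tw(G) ≤ β·|V(G)|^λ for every G ∈ C. Then for every ε < 1 there exists γ such that every G ∈ C contains a set X ⊆ V(G) with |X| ≤ ε·|V(G)| such that every connected component of G ∖ X has at most γ vertices. -/
open SimpleGraph Set

/-- A class of graphs (a predicate on graphs over arbitrary vertex types) is
hereditary if it is closed under taking induced subgraphs. -/
def GraphClassHereditary (C : ∀ V : Type, SimpleGraph V → Prop) : Prop :=
  ∀ (V : Type) (G : SimpleGraph V) (S : Set V), C V G → C S (G.induce S)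

namespace SimpleGraph

/-- In a tree rooted at `r`, a vertex has at most one neighbour closer to `r`. -/
lemma IsTree.eq_of_adj_of_dist_add_one_eq {ι : Type*} {T : SimpleGraph ι} (hT : T.IsTree)
    (r : ι) {v w₁ w₂ : ι} (h₁ : T.Adj w₁ v) (h₂ : T.Adj w₂ v)
    (d₁ : T.dist r w₁ + 1 = T.dist r v) (d₂ : T.dist r w₂ + 1 = T.dist r v) : w₁ = w₂ := by
  obtain ⟨p₁, hp₁⟩ := hT.connected.exists_walk_length_eq_dist r w₁
  obtain ⟨p₂, hp₂⟩ := hT.connected.exists_walk_length_eq_dist r w₂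
  have q₁ : (p₁.concat h₁).IsPath := Walk.isPath_of_length_eq_dist _ (by simp [hp₁, d₁])
  have q₂ : (p₂.concat h₂).IsPath := Walk.isPath_of_length_eq_dist _ (by simp [hp₂, d₂])
  have h := (hT.existsUnique_path r v).unique q₁ q₂
  simpa using congrArg Walk.penultimate h

/-- A rooted tree has a parent function, compatible with the distance to the root. -/
lemma IsTree.exists_parent {ι : Type*} {T : SimpleGraph ι} (hT : T.IsTree) (r : ι) :
    ∃ f : ι → ι, (∀ v, T.dist r (f v) = T.dist r v - 1) ∧
      ∀ v w, T.Adj v w → f w = v ∨ f v = w := by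
  classical
  let P : ι → ι → Prop := fun v w ↦ T.Adj w v ∧ T.dist r w + 1 = T.dist r v
  let f : ι → ι := fun v ↦ if h : ∃ w, P v w then h.choose else v
  have hf : ∀ v w, P v w → f v = w := by
    intro v w h
    have hex : ∃ w, P v w := ⟨w, h⟩
    have := hex.choose_spec
    simp only [f, dif_pos hex]
    exact hT.eq_of_adj_of_dist_add_one_eq r this.1 h.1 this.2 h.2
  refine ⟨f, fun v ↦ ?_, fun v w h ↦ ?_⟩
  · by_cases hex : ∃ w, P v w
    · obtain ⟨w, hw⟩ := hex
      rw [hf v w hw]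
      have := hw.2
      omega
    · have hv : f v = v := dif_neg hex
      rw [hv]
      rcases eq_or_ne (T.dist r v) 0 with h0 | h0
      · omega
      · exfalso
        obtain ⟨p, hp⟩ := hT.connected.exists_walk_length_eq_dist v r
        cases p with
        | nil => simp at h0
        | cons h q =>
          rename_i w
          rw [dist_comm] at hp
          have := T.dist_le q
          rw [dist_comm] at this
          simp only [Walk.length_cons] at hp
          have := hT.dist_eq_dist_add_one_of_adj r h
          exact hex ⟨w, h.symm, by omega⟩
  · rcases hT.dist_eq_dist_add_one_of_adj r h with h' | h'
    · exact Or.inr (hf v w ⟨h.symm, h'.symm⟩)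
    · exact Or.inl (hf w v ⟨h, h'.symm⟩)

/-- In a rooted tree with parent function `f`, all vertices of a subtree `A` reach a topmost
vertex `t` of `A` by climbing inside `A`. -/
lemma IsTree.exists_iterate_eq_of_preconnected {ι : Type*} {T : SimpleGraph ι} (hT : T.IsTree)
    {r : ι} {f : ι → ι} (hd : ∀ v, T.dist r (f v) = T.dist r v - 1)
    (hf : ∀ v w, T.Adj v w → f w = v ∨ f v = w)
    {A : Set ι} (hA : (T.induce A).Preconnected) {t : ι} (ht : t ∈ A)
    (hmin : ∀ x ∈ A, T.dist r t ≤ T.dist r x) {x : ι} (hx : x ∈ A) :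
    ∃ k, f^[k] x = t ∧ ∀ j ≤ k, f^[j] x ∈ A := by
  have key : ∀ y : A, Relation.ReflTransGen (T.induce A).Adj ⟨t, ht⟩ y →
      ∃ k, f^[k] y = t ∧ ∀ j ≤ k, f^[j] y ∈ A := by
    intro y hy
    induction hy with
    | refl => exact ⟨0, rfl, fun j hj ↦ by simp [Nat.le_zero.1 hj, ht]⟩
    | @tail y z _ hyz ih =>
      obtain ⟨k, hk, hkA⟩ := ih
      have hyz : T.Adj y z := hyz
      rcases hf _ _ hyz with h | h
      · refine ⟨k + 1, by simpa [h] using hk, fun j hj ↦ ?_⟩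
        cases j with
        | zero => exact z.2
        | succ j => simpa [h] using hkA j (by omega)
      · cases k with
        | zero =>
          have hyt : (y : ι) = t := hk
          have hzt : T.dist r z = T.dist r t - 1 := by rw [← h, hd, hyt]
          have := hmin z z.2
          have := hT.dist_ne_of_adj r hyz
          rw [hyt] at this
          omega
        | succ k =>
          refine ⟨k, by simpa [h] using hk, fun j hj ↦ ?_⟩
          simpa [h] using hkA (j + 1) (by omega)
  exact key ⟨x, hx⟩ ((reachable_iff_reflTransGen _ _).1 (hA _ _))

/-- Helly property: finitely many pairwise intersecting subtrees of a tree have a common vertex. -/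
lemma IsTree.exists_mem_of_pairwise_inter_nonempty {ι κ : Type*} {T : SimpleGraph ι}
    (hT : T.IsTree) [Finite κ] (F : κ → Set ι) (hF : ∀ a, (T.induce (F a)).Preconnected)
    (hint : ∀ a b, (F a ∩ F b).Nonempty) : ∃ t, ∀ a, t ∈ F a := by
  obtain ⟨r⟩ := hT.connected.nonempty
  rcases isEmpty_or_nonempty κ with hκ | hκ
  · exact ⟨r, fun a ↦ isEmptyElim a⟩
  obtain ⟨f, hd, hf⟩ := hT.exists_parent r
  have htop : ∀ a, ∃ t ∈ F a, ∀ x ∈ F a, T.dist r t ≤ T.dist r x := fun a ↦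
    exists_minimalFor_of_wellFoundedLT (· ∈ F a) (T.dist r)
      (by simpa [Set.Nonempty] using hint a a) |>.imp fun t ht ↦ ⟨ht.1, fun x hx ↦ by
        by_contra! h
        exact absurd (ht.2 hx h.le) (by omega)⟩
  choose top htop hmin using htop
  obtain ⟨a, ha⟩ := Finite.exists_max fun a ↦ T.dist r (top a)
  have hdist : ∀ k v, T.dist r (f^[k] v) = T.dist r v - k := by
    intro k
    induction k with
    | zero => simp
    | succ k ih =>
      intro v
      rw [Function.iterate_succ_apply, ih, hd]
      omega
  refine ⟨top a, fun b ↦ ?_⟩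
  obtain ⟨x, hxa, hxb⟩ := hint a b
  obtain ⟨k, hk, -⟩ := hT.exists_iterate_eq_of_preconnected hd hf (hF a) (htop a) (hmin a) hxa
  obtain ⟨l, hl, hlb⟩ := hT.exists_iterate_eq_of_preconnected hd hf (hF b) (htop b) (hmin b) hxb
  rcases le_or_gt k l with hkl | hkl
  · exact hk ▸ hlb k hkl
  · have h₁ := hdist k x
    have h₂ := hdist l x
    have h₃ := ha b
    rw [hk] at h₁
    rw [hl] at h₂
    have h₄ : top a = top b := by
      rw [← hT.connected.dist_eq_zero_iff.1 (show T.dist r (top a) = 0 by omega),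
        ← hT.connected.dist_eq_zero_iff.1 (show T.dist r (top b) = 0 by omega)]
    exact h₄ ▸ htop b

/-- The bags of a tree decomposition meeting a connected vertex set form a subtree. -/
lemma preconnected_induce_setOf_bag_inter_nonempty {V ι : Type*} {G : SimpleGraph V}
    {T : SimpleGraph ι} {bag : ι → Set V}
    (hedge : ∀ u w : V, G.Adj u w → ∃ i, u ∈ bag i ∧ w ∈ bag i)
    (hconn : ∀ v : V, (T.induce {i | v ∈ bag i}).Connected)
    {W : Set V} (hW : (G.induce W).Preconnected) :
    (T.induce {i | (bag i ∩ W).Nonempty}).Preconnected := by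
  have hvert : ∀ v ∈ W, ∀ i j, ∀ hi : v ∈ bag i, ∀ hj : v ∈ bag j, ∀ hi' hj',
      (T.induce {i | (bag i ∩ W).Nonempty}).Reachable ⟨i, hi'⟩ ⟨j, hj'⟩ := by
    intro v hv i j hi hj hi' hj'
    have hsub : {i | v ∈ bag i} ⊆ {i | (bag i ∩ W).Nonempty} := fun i hi ↦ ⟨v, hi, hv⟩
    exact ((hconn v).preconnected ⟨i, hi⟩ ⟨j, hj⟩).map (induceHomOfLE T hsub).toHom
  rintro ⟨i, u, hui, huW⟩ ⟨j, w, hwj, hwW⟩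
  have key : ∀ w : W, Relation.ReflTransGen (G.induce W).Adj ⟨u, huW⟩ w →
      ∀ j, ∀ hj : (w : V) ∈ bag j,
      (T.induce {i | (bag i ∩ W).Nonempty}).Reachable ⟨i, u, hui, huW⟩ ⟨j, w, hj, w.2⟩ := by
    intro w hw
    induction hw with
    | refl => exact fun j hj ↦ hvert u huW i j hui hj _ _
    | @tail y z _ hyz ih =>
      intro j hj
      obtain ⟨k, hyk, hzk⟩ := hedge y z hyz
      exact (ih k hyk).trans (hvert z z.2 k j hzk hj _ _)
  exact key ⟨w, hwW⟩ ((reachable_iff_reflTransGen _ _).1 (hW _ _)) j hwj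

/-- A graph of treewidth at most `k` has a balanced separator with at most `k + 1` vertices. -/
lemma TreewidthLE.exists_balanced_separator {V : Type} [Fintype V] {G : SimpleGraph V} {k : ℕ}
    (h : G.TreewidthLE k) : ∃ S : Set V, S.ncard ≤ k + 1 ∧
      ∀ W : Set V, Disjoint W S → (G.induce W).Preconnected →
        2 * W.ncard ≤ Fintype.card V := by
  obtain ⟨ι, T, bag, hT, hvert, hedge, hconn, hbag⟩ := h
  let κ := {W : Set V // (G.induce W).Preconnected ∧ Fintype.card V < 2 * W.ncard}
  obtain ⟨t, ht⟩ := hT.exists_mem_of_pairwise_inter_nonempty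
    (fun W : κ ↦ {i | (bag i ∩ W.1).Nonempty})
    (fun W ↦ preconnected_induce_setOf_bag_inter_nonempty hedge hconn W.2.1) (by
      intro W W'
      have hWW' : (W.1 ∩ W'.1).Nonempty := by
        rw [Set.nonempty_iff_ne_empty]
        intro h0
        have h1 := Set.ncard_union_add_ncard_inter W.1 W'.1
        have h2 : (W.1 ∪ W'.1).ncard ≤ Nat.card V := Set.ncard_le_card _
        rw [h0, Set.ncard_empty] at h1
        rw [Nat.card_eq_fintype_card] at h2
        have := W.2.2
        have := W'.2.2
        omega
      obtain ⟨v, hv, hv'⟩ := hWW'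
      obtain ⟨i, hi⟩ := hvert v
      exact ⟨i, ⟨v, hi, hv⟩, ⟨v, hi, hv'⟩⟩)
  refine ⟨bag t, (hbag t).2, fun W hdisj hW ↦ ?_⟩
  by_contra! hlt
  obtain ⟨v, hv, hvW⟩ := ht ⟨W, hW, hlt⟩
  exact Set.disjoint_left.1 hdisj hvW hv

/-- The treewidth of a finite graph is the width of some tree decomposition. -/
lemma treewidthLE_treewidth {V : Type} [Finite V] (G : SimpleGraph V) :
    G.TreewidthLE G.treewidth := by
  refine Nat.sInf_mem (s := {k | G.TreewidthLE k}) ⟨Nat.card V, Unit, ⊥, fun _ ↦ Set.univ,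
    IsTree.of_subsingleton, fun v ↦ ⟨(), trivial⟩, fun _ _ _ ↦ ⟨(), trivial, trivial⟩,
    fun v ↦ ?_, fun _ ↦ ⟨Set.toFinite _, ?_⟩⟩
  · have : Nonempty {i : Unit | v ∈ (Set.univ : Set V)} := ⟨⟨(), trivial⟩⟩
    exact Connected.of_subsingleton
  · rw [Set.ncard_univ]
    omega

/-- Connectedness of a vertex set does not depend on the induced subgraph in which it is
considered. -/
lemma preconnected_induce_image {V : Type*} {G : SimpleGraph V} {K : Set V} {W : Set K} :
    (G.induce (Subtype.val '' W)).Preconnected ↔ ((G.induce K).induce W).Preconnected := by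
  have e : (G.induce K).induce W ≃g G.induce (Subtype.val '' W) :=
    { toEquiv := Equiv.Set.image _ W Subtype.val_injective
      map_rel_iff' := by simp }
  exact e.symm.preconnected_iff

end SimpleGraph

/-- Recursive use of balanced separators: if `h` is a bound on the density of the deletion set that
pays for one separator at every size above `γ`, then it pays for the whole deletion set. -/
lemma exists_deletion_set_of_potential
    {C : ∀ V : Type, SimpleGraph V → Prop} (hher : GraphClassHereditary C) (γ : ℕ) (h : ℝ → ℝ)
    (h0 : ∀ x, 0 ≤ h x) (hmono : MonotoneOn h (Set.Ioi 0))
    (hstep : ∀ (V : Type) [Fintype V] (G : SimpleGraph V), C V G → γ < Fintype.card V →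
      (G.treewidth : ℝ) + 1 + Fintype.card V * h (Fintype.card V / 2) ≤
        Fintype.card V * h (Fintype.card V))
    (V : Type) [Fintype V] (G : SimpleGraph V) (hG : C V G) :
    ∃ X : Set V, (X.ncard : ℝ) ≤ Fintype.card V * h (Fintype.card V) ∧
      ∀ W : Set V, Disjoint W X → (G.induce W).Preconnected → W.ncard ≤ γ := by
  classical
  induction hn : Fintype.card V using Nat.strong_induction_on generalizing V with
  | _ n ih =>
  subst hn
  rcases le_or_gt (Fintype.card V) γ with hγ | hγ
  · refine ⟨∅, by simpa using mul_nonneg (Nat.cast_nonneg _) (h0 _), fun W _ _ ↦ ?_⟩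
    have := Set.ncard_le_card W
    rw [Nat.card_eq_fintype_card] at this
    omega
  obtain ⟨S, hS, hbal⟩ := (treewidthLE_treewidth G).exists_balanced_separator
  let K : (G.induce Sᶜ).ConnectedComponent → Set V := fun c ↦ Subtype.val '' c.supp
  have hKS : ∀ c, Disjoint (K c) S := by
    intro c
    rw [Set.disjoint_left]
    rintro _ ⟨v, -, rfl⟩
    exact v.2
  have hKconn : ∀ c, (G.induce (K c)).Preconnected := fun c ↦
    preconnected_induce_image.2 c.maximal_connected_induce_supp.prop.preconnected
  have hKne : ∀ c, 0 < (K c).ncard := fun c ↦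
    (Set.ncard_pos (Set.toFinite _)).2 (c.nonempty_supp.image _)
  have hKcard : ∀ c, 2 * (K c).ncard ≤ Fintype.card V := fun c ↦ hbal _ (hKS c) (hKconn c)
  have hKdisj : Pairwise (Function.onFun Disjoint K) := by
    intro c d hcd
    simp only [Function.onFun, Set.disjoint_left]
    rintro _ ⟨v, hv, rfl⟩ ⟨w, hw, hwv⟩
    obtain rfl := Subtype.val_injective hwv
    exact hcd (ConnectedComponent.eq_of_common_vertex hv hw)
  have hX : ∀ c, ∃ X : Set (K c), (X.ncard : ℝ) ≤ (K c).ncard * h (Fintype.card V / 2) ∧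
      ∀ W : Set (K c), Disjoint W X → ((G.induce (K c)).induce W).Preconnected → W.ncard ≤ γ := by
    intro c
    have hcard : Fintype.card (K c) = (K c).ncard := by
      rw [← Nat.card_eq_fintype_card, Nat.card_coe_set_eq]
    have h1 := hKne c
    have h2 := hKcard c
    obtain ⟨X, hX, hXW⟩ := ih _ (by omega) (K c) (G.induce (K c)) (hher V G _ hG) rfl
    refine ⟨X, hX.trans ?_, hXW⟩
    rw [hcard]
    refine mul_le_mul_of_nonneg_left (hmono ?_ ?_ ?_) (Nat.cast_nonneg _)
    · exact Set.mem_Ioi.2 (by exact_mod_cast h1)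
    · exact Set.mem_Ioi.2 (by have : 0 < Fintype.card V := (by omega); positivity)
    · have : (2 * (K c).ncard : ℝ) ≤ Fintype.card V := by exact_mod_cast h2
      linarith
  choose X hXcard hXW using hX
  refine ⟨S ∪ ⋃ c, Subtype.val '' X c, ?_, fun W hW hWconn ↦ ?_⟩
  · have hsum : ∑ c, (K c).ncard ≤ Fintype.card V := by
      rw [← Nat.card_eq_fintype_card, ← finsum_eq_sum_of_fintype,
        ← Set.ncard_iUnion_of_finite (fun _ ↦ Set.toFinite _) hKdisj]
      exact Set.ncard_le_card _
    have hle : (S ∪ ⋃ c, Subtype.val '' X c).ncard ≤ S.ncard + ∑ c, (X c).ncard := by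
      refine (Set.ncard_union_le _ _).trans (Nat.add_le_add_left ?_ _)
      refine (Set.ncard_iUnion_le_of_fintype _).trans (Finset.sum_le_sum fun c _ ↦ ?_)
      exact Set.ncard_image_le (Set.toFinite _)
    calc ((S ∪ ⋃ c, Subtype.val '' X c).ncard : ℝ)
        ≤ S.ncard + ∑ c, ((X c).ncard : ℝ) := by exact_mod_cast hle
      _ ≤ (G.treewidth + 1) + ∑ c, (K c).ncard * h (Fintype.card V / 2) :=
          add_le_add (by exact_mod_cast hS) (Finset.sum_le_sum fun c _ ↦ hXcard c)
      _ = (G.treewidth + 1) + ((∑ c, (K c).ncard : ℕ) : ℝ) * h (Fintype.card V / 2) := by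
          rw [← Finset.sum_mul]
          push_cast
          rfl
      _ ≤ (G.treewidth + 1) + Fintype.card V * h (Fintype.card V / 2) := by
          have := h0 (Fintype.card V / 2)
          gcongr
      _ ≤ _ := hstep V G hG hγ
  · rcases W.eq_empty_or_nonempty with rfl | ⟨w, hw⟩
    · simp
    rw [Set.disjoint_union_right] at hW
    have hWS : W ⊆ Sᶜ := Set.disjoint_left.1 hW.1
    let c := (G.induce Sᶜ).connectedComponentMk ⟨w, hWS hw⟩
    have hWK : W ⊆ K c := by
      intro v hv
      refine ⟨⟨v, hWS hv⟩, ?_, rfl⟩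
      exact ConnectedComponent.sound
        ((hWconn ⟨v, hv⟩ ⟨w, hw⟩).map (induceHomOfLE G hWS).toHom)
    have himg : Subtype.val '' (Subtype.val ⁻¹' W : Set (K c)) = W := by
      simpa using hWK
    rw [← himg, Set.ncard_image_of_injective _ Subtype.val_injective]
    refine hXW c _ ?_ (preconnected_induce_image.1 (by rwa [himg]))
    rw [Set.disjoint_left]
    intro v hv hvX
    exact Set.disjoint_left.1 hW.2 hv (Set.mem_iUnion.2 ⟨c, v, hvX, rfl⟩)

/-- The potential `max 0 (ε - D x ^ (lam - 1))` gains `B n ^ lam` from `n / 2` to `n`. -/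
lemma exists_density_potential (lam : ℝ) (hlam1 : lam < 1) (B : ℝ) (hB : 0 ≤ B)
    (ε : ℝ) (hε : 0 < ε) :
    ∃ (γ : ℕ) (h : ℝ → ℝ), (∀ x, 0 ≤ h x) ∧ MonotoneOn h (Set.Ioi 0) ∧ (∀ x, 0 ≤ x → h x ≤ ε) ∧
      ∀ n : ℕ, γ < n → B * (n : ℝ) ^ lam + n * h (n / 2) ≤ n * h n := by
  have h2 : (1 : ℝ) < 2 ^ (1 - lam) := Real.one_lt_rpow (by norm_num) (by linarith)
  set q : ℝ := 2 ^ (1 - lam) with hq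
  have hD : 0 ≤ B / (q - 1) := div_nonneg hB (by linarith)
  have hDB : B / (q - 1) * (q - 1) = B := div_mul_cancel₀ _ (by linarith)
  set D := B / (q - 1)
  have hanti : ∀ x y : ℝ, 0 < x → x ≤ y → D * y ^ (lam - 1) ≤ D * x ^ (lam - 1) := fun x y hx hxy ↦
    mul_le_mul_of_nonneg_left (Real.rpow_le_rpow_of_nonpos hx hxy (by linarith)) hD
  have hlim : Filter.Tendsto (fun n : ℕ ↦ D * q * (n : ℝ) ^ (lam - 1)) Filter.atTop (nhds 0) := by
    have := ((tendsto_rpow_neg_atTop (show 0 < 1 - lam by linarith)).comp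
      tendsto_natCast_atTop_atTop).const_mul (D * q)
    simpa [Function.comp_def] using this
  obtain ⟨γ, hγ⟩ := Filter.eventually_atTop.1 (hlim.eventually (gt_mem_nhds hε))
  refine ⟨γ, fun x ↦ max 0 (ε - D * x ^ (lam - 1)), fun x ↦ le_max_left _ _, ?_, ?_, ?_⟩
  · intro x hx y _ hxy
    exact max_le_max le_rfl (by linarith [hanti x y hx hxy])
  · intro x hx
    exact max_le hε.le (by linarith [mul_nonneg hD (Real.rpow_nonneg hx (lam - 1))])
  · intro n hn
    have hn0 : (0 : ℝ) < n := by exact_mod_cast (Nat.zero_le γ).trans_lt hn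
    have hhalf : ((n : ℝ) / 2) ^ (lam - 1) = q * (n : ℝ) ^ (lam - 1) := by
      rw [Real.div_rpow hn0.le (by norm_num), hq, div_eq_mul_inv, ← Real.rpow_neg (by norm_num),
        neg_sub, mul_comm]
    have hpow : (n : ℝ) ^ lam = n * (n : ℝ) ^ (lam - 1) := by
      rw [Real.rpow_sub_one hn0.ne']
      field_simp
    have hpos : 0 ≤ ε - D * ((n : ℝ) / 2) ^ (lam - 1) := by
      rw [hhalf]
      linarith [hγ n hn.le]
    simp only
    rw [max_eq_right hpos]
    refine le_trans (le_of_eq ?_)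
      (mul_le_mul_of_nonneg_left (le_max_right 0 (ε - D * (n : ℝ) ^ (lam - 1))) hn0.le)
    rw [hhalf, hpow, ← hDB]
    ring

/-- Let `C` be a hereditary graph class of sublinear treewidth with
parameter `λ ∈ (0,1)`, i.e. there is a constant `β` with `tw(G) ≤ β·|V(G)|^λ` for every
`G ∈ C`.  Then for every `ε < 1` there exists `γ` such that every `G ∈ C` contains a
set `X ⊆ V(G)` with `|X| ≤ ε·|V(G)|` such that every connected component of `G ∖ X`
has at most `γ` vertices. -/
theorem exists_small_deletion_set_of_sublinear_treewidth
    (C : ∀ V : Type, SimpleGraph V → Prop) (hher : GraphClassHereditary C)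
    (lam : ℝ) (hlam0 : 0 < lam) (hlam1 : lam < 1)
    (β : ℝ) (hβ : ∀ (V : Type) [Fintype V] (G : SimpleGraph V), C V G →
      (G.treewidth : ℝ) ≤ β * (Fintype.card V : ℝ) ^ lam) :
    ∀ ε : ℝ, 0 < ε → ε < 1 → ∃ γ : ℕ,
      ∀ (V : Type) [Fintype V] (G : SimpleGraph V), C V G →
        ∃ X : Set V, (X.ncard : ℝ) ≤ ε * (Fintype.card V : ℝ) ∧
          ∀ c : (G.induce Xᶜ).ConnectedComponent, c.supp.ncard ≤ γ := by
  intro ε hε _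
  obtain ⟨γ, h, h0, hmono, hle, hgain⟩ :=
    exists_density_potential lam hlam1 (max β 0 + 1) (by positivity) ε hε
  refine ⟨γ, fun V _ G hG ↦ ?_⟩
  obtain ⟨X, hX, hXW⟩ := exists_deletion_set_of_potential hher γ h h0 hmono
    (fun V _ G hG hγ ↦ by
      refine le_trans (add_le_add_left ?_ _) (hgain _ hγ)
      have hn : (1 : ℝ) ≤ Fintype.card V := by exact_mod_cast (Nat.zero_le γ).trans_lt hγ
      have h1 : (1 : ℝ) ≤ (Fintype.card V : ℝ) ^ lam := Real.one_le_rpow hn hlam0.le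
      have h2 := hβ V G hG
      have h3 : β * (Fintype.card V : ℝ) ^ lam ≤ max β 0 * (Fintype.card V : ℝ) ^ lam :=
        mul_le_mul_of_nonneg_right (le_max_left _ _) (by linarith)
      linarith) V G hG
  refine ⟨X, hX.trans ?_, fun c ↦ ?_⟩
  · rw [mul_comm]
    exact mul_le_mul_of_nonneg_right (hle _ (Nat.cast_nonneg _)) (Nat.cast_nonneg _)
  · rw [← Set.ncard_image_of_injective _ Subtype.val_injective]
    refine hXW _ ?_
      (preconnected_induce_image.2 c.maximal_connected_induce_supp.prop.preconnected)
    rw [Set.disjoint_left]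
    rintro _ ⟨v, -, rfl⟩
    exact v.2
end
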